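/- arXiv:math/0504159 — 2 statements merged into one kernel-verified Lean document; each statement's English description precedes it below -/
import Mathlib

section
/- Let u : ℝ³ → ℝ (coordinates (t, x₁, x₂)) be C^∞ on some open neighborhood of the origin, and suppose P_H u = ∂²u/∂t² + t²(∂²u/∂x₁² + ∂²u/∂x₂²) + ∂_θ(∂_θ u) is real-analytic on some open neighborhood of the origin. Then there exists an open neighborhood of the origin on which u is real-analytic (i.e., P_H is analytic hypoelliptic in the sense of germs at the origin, for smooth functions). -/
/-- Partial derivative in `t` on `ℝ³ = ℝ_t × ℝ_{x₁} × ℝ_{x₂}`. -/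
noncomputable def Dt (f : ℝ × ℝ × ℝ → ℝ) : ℝ × ℝ × ℝ → ℝ :=
  fun p => fderiv ℝ f p (1, 0, 0)

/-- Partial derivative in `x₁`. -/
noncomputable def Dx1 (f : ℝ × ℝ × ℝ → ℝ) : ℝ × ℝ × ℝ → ℝ :=
  fun p => fderiv ℝ f p (0, 1, 0)

/-- Partial derivative in `x₂`. -/
noncomputable def Dx2 (f : ℝ × ℝ × ℝ → ℝ) : ℝ × ℝ × ℝ → ℝ :=
  fun p => fderiv ℝ f p (0, 0, 1)

/-- The angular vector field `∂_θ f = x₁ ∂f/∂x₂ − x₂ ∂f/∂x₁`. -/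
noncomputable def Dtheta (f : ℝ × ℝ × ℝ → ℝ) : ℝ × ℝ × ℝ → ℝ :=
  fun p => p.2.1 * Dx2 f p - p.2.2 * Dx1 f p

/-- Hanges' operator `P_H = ∂_t² + t²(∂_{x₁}² + ∂_{x₂}²) + ∂_θ²`. -/
noncomputable def PH (u : ℝ × ℝ × ℝ → ℝ) : ℝ × ℝ × ℝ → ℝ :=
  fun p => Dt (Dt u) p + p.1 ^ 2 * (Dx1 (Dx1 u) p + Dx2 (Dx2 u) p) + Dtheta (Dtheta u) p

open scoped ContDiff Nat NNReal ENNReal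

theorem analyticAt_of_norm_iteratedFDeriv_le {E F : Type*} [NormedAddCommGroup E]
    [NormedSpace ℝ E] [NormedAddCommGroup F] [NormedSpace ℝ F] [CompleteSpace F]
    {f : E → F} (hf : ContDiff ℝ ∞ f) {x : E} {r C : ℝ} (hr : 0 < r) (hC : 1 ≤ C)
    (h : ∀ (n : ℕ), ∀ y ∈ Metric.ball x r, ‖iteratedFDeriv ℝ n f y‖ ≤ C ^ (n + 1) * n !) :
    AnalyticAt ℝ f x := by
  have hC0 : 0 < C := by linarith
  set δ : ℝ := min r (1 / (2 * C)) with hδ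
  have hδ0 : 0 < δ := by positivity
  have hCδ : C * δ ≤ 1 / 2 := by
    calc C * δ ≤ C * (1 / (2 * C)) := by gcongr; exact min_le_right _ _
      _ = 1 / 2 := by field_simp
  let p : FormalMultilinearSeries ℝ E F := fun n ↦ (n ! : ℝ)⁻¹ • iteratedFDeriv ℝ n f x
  have hp (n : ℕ) : ‖p n‖ ≤ C ^ (n + 1) := by
    have := h n x (Metric.mem_ball_self hr)
    simp only [p, norm_smul, norm_inv, RCLike.norm_natCast]
    rw [inv_mul_le_iff₀ (by positivity)]
    linarith
  refine ⟨p, ENNReal.ofReal δ, ⟨?_, by simpa using hδ0, ?_⟩⟩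
  · refine p.le_radius_of_bound (r := δ.toNNReal) C fun n ↦ ?_
    rw [Real.coe_toNNReal _ hδ0.le]
    calc ‖p n‖ * δ ^ n ≤ C ^ (n + 1) * δ ^ n := by gcongr; exact hp n
      _ = C * (C * δ) ^ n := by ring
      _ ≤ C * 1 := by gcongr; exact pow_le_one₀ (by positivity) (by linarith)
      _ = C := mul_one C
  · intro y hy
    have hy' : ‖y‖ < δ := by
      rw [Metric.eball_ofReal] at hy
      simpa using hy
    have hterm (n : ℕ) : ‖p n fun _ ↦ y‖ ≤ C * (1 / 2) ^ n := by
      calc ‖p n fun _ ↦ y‖ ≤ ‖p n‖ * ∏ i : Fin n, ‖y‖ := (p n).le_opNorm _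
        _ = ‖p n‖ * ‖y‖ ^ n := by simp
        _ ≤ C ^ (n + 1) * δ ^ n := by gcongr; exact hp n
        _ = C * (C * δ) ^ n := by ring
        _ ≤ C * (1 / 2) ^ n := by gcongr
    have hsum : Summable fun n ↦ p n fun _ ↦ y :=
      .of_norm_bounded ((summable_geometric_of_lt_one (by norm_num) (by norm_num)).mul_left C) hterm
    rw [hsum.hasSum_iff_tendsto_nat, ← Filter.tendsto_add_atTop_iff_nat 1,
      tendsto_iff_norm_sub_tendsto_zero]
    have hlim : Filter.Tendsto (fun n : ℕ ↦ C * (((n + 1 : ℕ) : ℝ) * (1 / 2) ^ (n + 1)))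
        Filter.atTop (nhds 0) := by
      have := (tendsto_self_mul_const_pow_of_lt_one (r := (1 / 2 : ℝ)) (by norm_num)
        (by norm_num)).comp (Filter.tendsto_add_atTop_nat 1)
      simpa using this.const_mul C
    refine squeeze_zero (fun _ ↦ norm_nonneg _) (fun n ↦ ?_) hlim
    have htay := map_add_eq_sum_add_integral_iteratedFDeriv (n := n) (f := f) (x := x) (y := y)
      fun t _ ↦ (hf.of_le (by exact_mod_cast le_top)).contDiffAt
    have hrem : ‖∫ t in (0 : ℝ)..1, (1 - t) ^ n •
        iteratedFDeriv ℝ (n + 1) f (x + t • y) (fun _ ↦ y)‖ ≤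
        (C ^ (n + 2) * (n + 1)! * δ ^ (n + 1)) * |1 - 0| := by
      refine intervalIntegral.norm_integral_le_of_norm_le_const fun t ht ↦ ?_
      rw [Set.uIoc_of_le zero_le_one] at ht
      have hball : x + t • y ∈ Metric.ball x r := by
        simp only [Metric.mem_ball, dist_self_add_left, norm_smul, Real.norm_eq_abs,
          abs_of_pos ht.1]
        calc t * ‖y‖ ≤ 1 * ‖y‖ := by gcongr; exact ht.2
          _ < r := by rw [one_mul]; exact hy'.trans_le (min_le_left _ _)
      rw [norm_smul]
      calc ‖(1 - t) ^ n‖ * ‖iteratedFDeriv ℝ (n + 1) f (x + t • y) (fun _ ↦ y)‖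
          ≤ 1 * (‖iteratedFDeriv ℝ (n + 1) f (x + t • y)‖ * ∏ i : Fin (n + 1), ‖y‖) := by
            gcongr
            · rw [norm_pow]
              refine pow_le_one₀ (norm_nonneg _) ?_
              rw [Real.norm_eq_abs, abs_le]; constructor <;> linarith [ht.1, ht.2]
            · exact ContinuousMultilinearMap.le_opNorm _ _
        _ = ‖iteratedFDeriv ℝ (n + 1) f (x + t • y)‖ * ‖y‖ ^ (n + 1) := by simp
        _ ≤ (C ^ (n + 1 + 1) * (n + 1)!) * δ ^ (n + 1) := by gcongr; exact h _ _ hball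
        _ = _ := by ring
    have heq : (∑ i ∈ Finset.range (n + 1), p i fun _ ↦ y) - f (x + y) =
        - ((n ! : ℝ)⁻¹ • ∫ t in (0 : ℝ)..1, (1 - t) ^ n •
        iteratedFDeriv ℝ (n + 1) f (x + t • y) (fun _ ↦ y)) := by
      rw [htay]; simp [p]
    rw [heq, norm_neg, norm_smul, norm_inv, RCLike.norm_natCast, inv_mul_le_iff₀ (by positivity)]
    refine hrem.trans ?_
    have h1 : (C * δ) ^ (n + 1) ≤ (1 / 2) ^ (n + 1) := by gcongr
    calc C ^ (n + 2) * (n + 1)! * δ ^ (n + 1) * |1 - 0|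
        = (n ! * C * ((n + 1 : ℕ) : ℝ)) * (C * δ) ^ (n + 1) := by
          rw [Nat.factorial_succ]; push_cast; simp; ring
      _ ≤ (n ! * C * ((n + 1 : ℕ) : ℝ)) * (1 / 2) ^ (n + 1) := by gcongr
      _ = _ := by ring

theorem AnalyticAt.exists_norm_iteratedFDeriv_le {E F : Type*} [NormedAddCommGroup E]
    [NormedSpace ℝ E] [NormedAddCommGroup F] [NormedSpace ℝ F] [CompleteSpace F]
    {f : E → F} {x : E} (hf : AnalyticAt ℝ f x) :
    ∃ r > 0, ∃ C ≥ (1 : ℝ), ∀ (n : ℕ), ∀ y ∈ Metric.ball x r,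
      ‖iteratedFDeriv ℝ n f y‖ ≤ C ^ (n + 1) * n ! := by
  obtain ⟨p, R, hp⟩ := hf
  obtain ⟨s, hs0, hsR⟩ := ENNReal.lt_iff_exists_nnreal_btwn.1 hp.r_pos
  have hs0' : 0 < s := by exact_mod_cast hs0
  set ρ : ℝ≥0 := s / 2 with hρ
  have hρ0 : 0 < ρ := by positivity
  have hrad : (ρ + ρ : ℝ≥0∞) < p.radius := by
    have : ρ + ρ = s := by rw [hρ]; exact add_halves s
    calc (ρ + ρ : ℝ≥0∞) = s := by exact_mod_cast this
      _ < p.radius := hsR.trans_le hp.r_le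
  have hρR : (ρ : ℝ≥0∞) < R := by
    refine lt_of_le_of_lt ?_ hsR
    exact_mod_cast half_le_self (by positivity)
  have hsm := p.changeOriginSeries_summable_aux₁ hrad
  set S := ∑' s : Σ k l : ℕ, { s : Finset (Fin (k + l)) // s.card = l },
      ‖p (s.1 + s.2.1)‖₊ * ρ ^ s.2.1 * ρ ^ s.1 with hS
  have hbound (k : ℕ) (y : E) (hy : ‖y‖₊ ≤ ρ) : ‖p.changeOrigin y k‖₊ * ρ ^ k ≤ S := by
    have hy' : (‖y‖₊ : ℝ≥0∞) < p.radius :=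
      (ENNReal.coe_le_coe.2 hy).trans_lt (hρR.trans_le hp.r_le)
    have hρ' : (ρ : ℝ≥0∞) < p.radius := hρR.trans_le hp.r_le
    calc ‖p.changeOrigin y k‖₊ * ρ ^ k
        ≤ (∑' s : Σ l : ℕ, { s : Finset (Fin (k + l)) // s.card = l },
            ‖p (k + s.1)‖₊ * ‖y‖₊ ^ s.1) * ρ ^ k := by
          gcongr; exact p.nnnorm_changeOrigin_le k hy'
      _ ≤ (∑' s : Σ l : ℕ, { s : Finset (Fin (k + l)) // s.card = l },
            ‖p (k + s.1)‖₊ * ρ ^ s.1) * ρ ^ k := by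
          gcongr
          · exact p.changeOriginSeries_summable_aux₂ hy' k
          · exact p.changeOriginSeries_summable_aux₂ hρ' k
      _ = ∑' s : Σ l : ℕ, { s : Finset (Fin (k + l)) // s.card = l },
            ‖p (k + s.1)‖₊ * ρ ^ s.1 * ρ ^ k := by rw [NNReal.tsum_mul_right]
      _ ≤ S := by
          exact NNReal.tsum_comp_le_tsum_of_inj hsm
            (i := fun s : Σ l : ℕ, { s : Finset (Fin (k + l)) // s.card = l } ↦ ⟨k, s⟩)
            (fun a b hab ↦ by simpa using hab)
  set C : ℝ := max 1 (max S (ρ : ℝ)⁻¹) with hC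
  have hC1 : 1 ≤ C := le_max_left _ _
  have hCS : (S : ℝ) ≤ C := (le_max_left _ _).trans (le_max_right _ _)
  have hCρ : (ρ : ℝ)⁻¹ ≤ C := (le_max_right _ _).trans (le_max_right _ _)
  refine ⟨ρ, by exact_mod_cast hρ0, C, hC1, fun n y hy ↦ ?_⟩
  have hyn : ‖y - x‖₊ ≤ ρ := by
    rw [mem_ball_iff_norm] at hy
    exact_mod_cast hy.le
  have hps := hp.changeOrigin (y := y - x) ((ENNReal.coe_le_coe.2 hyn).trans_lt hρR)
  rw [add_sub_cancel] at hps
  have hb : ‖p.changeOrigin (y - x) n‖ ≤ C ^ (n + 1) := by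
    have h1 : ‖p.changeOrigin (y - x) n‖ * (ρ : ℝ) ^ n ≤ S := by
      exact_mod_cast hbound n _ hyn
    have hρ1 : (0 : ℝ) < ρ := by exact_mod_cast hρ0
    calc ‖p.changeOrigin (y - x) n‖ ≤ S / (ρ : ℝ) ^ n := by
          rwa [le_div_iff₀ (by positivity)]
      _ = S * ((ρ : ℝ)⁻¹) ^ n := by rw [inv_pow]; rfl
      _ ≤ C * C ^ n := by gcongr
      _ = C ^ (n + 1) := by ring
  refine ContinuousMultilinearMap.opNorm_le_bound (by positivity) fun v ↦ ?_
  rw [hps.iteratedFDeriv_eq_sum_of_completeSpace]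
  calc ‖∑ σ : Equiv.Perm (Fin n), p.changeOrigin (y - x) n (fun i ↦ v (σ i))‖
      ≤ ∑ σ : Equiv.Perm (Fin n), C ^ (n + 1) * ∏ i, ‖v i‖ := by
        refine norm_sum_le_of_le _ fun σ _ ↦ ?_
        refine ((p.changeOrigin (y - x) n).le_opNorm _).trans ?_
        rw [Equiv.prod_comp σ fun i ↦ ‖v i‖]
        gcongr
    _ = C ^ (n + 1) * n ! * ∏ i, ‖v i‖ := by
        simp [Fintype.card_perm]; ring

/-- The algebra of smooth complex-valued functions on `ℝ³`. -/
def SmoothFn : Subalgebra ℂ (ℝ × ℝ × ℝ → ℂ) where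
  carrier := {f | ContDiff ℝ ∞ f}
  mul_mem' {f g} hf hg := ContDiff.mul (𝕜 := ℝ) (n := ∞) (f := f) (g := g) hf hg
  add_mem' {f g} hf hg := ContDiff.add (𝕜 := ℝ) (n := ∞) (f := f) (g := g) hf hg
  algebraMap_mem' c := contDiff_const (𝕜 := ℝ) (n := ∞) (c := c)

namespace SmoothFn

open MeasureTheory

instance : CoeFun SmoothFn fun _ ↦ ℝ × ℝ × ℝ → ℂ := ⟨Subtype.val⟩

theorem contDiff (f : SmoothFn) : ContDiff ℝ ∞ f := f.2

theorem continuous (f : SmoothFn) : Continuous f := (contDiff f).continuous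

theorem differentiable (f : SmoothFn) : Differentiable ℝ f := (contDiff f).differentiable (by simp)

@[ext] theorem ext {f g : SmoothFn} (h : ∀ p, f p = g p) : f = g := Subtype.ext (funext h)

@[simp] theorem add_apply (f g : SmoothFn) (p : ℝ × ℝ × ℝ) : (f + g) p = f p + g p := rfl
@[simp] theorem sub_apply (f g : SmoothFn) (p : ℝ × ℝ × ℝ) : (f - g) p = f p - g p := rfl
@[simp] theorem neg_apply (f : SmoothFn) (p : ℝ × ℝ × ℝ) : (-f) p = -f p := rfl
@[simp] theorem mul_apply (f g : SmoothFn) (p : ℝ × ℝ × ℝ) : (f * g) p = f p * g p := rfl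
@[simp] theorem smul_apply (c : ℂ) (f : SmoothFn) (p : ℝ × ℝ × ℝ) : (c • f) p = c * f p := rfl
@[simp] theorem pow_apply (f : SmoothFn) (n : ℕ) (p : ℝ × ℝ × ℝ) : (f ^ n) p = f p ^ n := rfl
@[simp] theorem one_apply (p : ℝ × ℝ × ℝ) : (1 : SmoothFn) p = 1 := rfl
@[simp] theorem zero_apply (p : ℝ × ℝ × ℝ) : (0 : SmoothFn) p = 0 := rfl
@[simp] theorem natCast_apply (n : ℕ) (p : ℝ × ℝ × ℝ) : (n : SmoothFn) p = n := rfl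
@[simp] theorem intCast_apply (n : ℤ) (p : ℝ × ℝ × ℝ) : (n : SmoothFn) p = n := rfl
@[simp] theorem ofNat_apply (n : ℕ) [n.AtLeastTwo] (p : ℝ × ℝ × ℝ) :
    (ofNat(n) : SmoothFn) p = OfNat.ofNat n := rfl

/-- The directional derivative along a constant vector, as a derivation. -/
noncomputable def pd (e : ℝ × ℝ × ℝ) : Derivation ℂ SmoothFn SmoothFn :=
  Derivation.mk'
    { toFun := fun f ↦ ⟨fun p ↦ fderiv ℝ f p e, by
        have : ContDiff ℝ ∞ (fderiv ℝ f) := (contDiff f).fderiv_right (by simp)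
        exact this.clm_apply contDiff_const⟩
      map_add' := fun f g ↦ by
        ext p
        change fderiv ℝ ((f : ℝ × ℝ × ℝ → ℂ) + (g : ℝ × ℝ × ℝ → ℂ)) p e =
          fderiv ℝ f p e + fderiv ℝ g p e
        rw [fderiv_add (differentiable f).differentiableAt (differentiable g).differentiableAt]; rfl
      map_smul' := fun c f ↦ by
        ext p
        change fderiv ℝ (c • (f : ℝ × ℝ × ℝ → ℂ)) p e = c * fderiv ℝ f p e
        rw [fderiv_const_smul (differentiable f).differentiableAt]; rfl }
    fun f g ↦ by
      ext p
      change fderiv ℝ ((f : ℝ × ℝ × ℝ → ℂ) * (g : ℝ × ℝ × ℝ → ℂ)) p e =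
        f p * fderiv ℝ g p e + g p * fderiv ℝ f p e
      rw [fderiv_mul (differentiable f).differentiableAt (differentiable g).differentiableAt]; rfl

theorem pd_apply (e : ℝ × ℝ × ℝ) (f : SmoothFn) (p : ℝ × ℝ × ℝ) : pd e f p = fderiv ℝ f p e := rfl

theorem pd_comm (e e' : ℝ × ℝ × ℝ) (f : SmoothFn) : pd e (pd e' f) = pd e' (pd e f) := by
  ext p
  have hd : DifferentiableAt ℝ (fderiv ℝ f) p :=
    ((contDiff f).fderiv_right (m := ∞) (by simp)).differentiable (by simp) p
  have key (a b : ℝ × ℝ × ℝ) : pd a (pd b f) p = fderiv ℝ (fderiv ℝ f) p a b := by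
    change fderiv ℝ (fun q ↦ fderiv ℝ f q b) p a = _
    rw [fderiv_clm_apply hd (differentiableAt_const b)]
    simp
  rw [key, key]
  refine ((contDiff f).contDiffAt (x := p)).isSymmSndFDerivAt ?_ e e'
  rw [minSmoothness_of_isRCLikeNormedField]
  exact WithTop.coe_le_coe.2 le_top

/-- The pointwise complex conjugate of a smooth function. -/
noncomputable def conj (f : SmoothFn) : SmoothFn :=
  ⟨fun p ↦ Complex.conjCLE (f p), Complex.conjCLE.contDiff.comp (contDiff f)⟩

@[simp] theorem conj_apply (f : SmoothFn) (p : ℝ × ℝ × ℝ) :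
    conj f p = starRingEnd ℂ (f p) := rfl

theorem pd_conj (e : ℝ × ℝ × ℝ) (f : SmoothFn) : pd e (conj f) = conj (pd e f) := by
  ext p
  change fderiv ℝ (Complex.conjCLE ∘ f) p e = _
  rw [ContinuousLinearEquiv.comp_fderiv]
  rfl

/-- A smooth real-valued function, regarded as complex-valued. -/
noncomputable def ofReal (f : ℝ × ℝ × ℝ → ℝ) (hf : ContDiff ℝ ∞ f) : SmoothFn :=
  ⟨fun p ↦ Complex.ofRealCLM (f p), Complex.ofRealCLM.contDiff.comp hf⟩

@[simp] theorem ofReal_apply (f : ℝ × ℝ × ℝ → ℝ) (hf : ContDiff ℝ ∞ f) (p : ℝ × ℝ × ℝ) :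
    ofReal f hf p = (f p : ℂ) := rfl

theorem pd_ofReal (e : ℝ × ℝ × ℝ) (f : ℝ × ℝ × ℝ → ℝ) (hf : ContDiff ℝ ∞ f) (p : ℝ × ℝ × ℝ) :
    pd e (ofReal f hf) p = (fderiv ℝ f p e : ℂ) := by
  change fderiv ℝ (Complex.ofRealCLM ∘ f) p e = _
  rw [fderiv_comp p Complex.ofRealCLM.differentiableAt (hf.differentiable (by simp) p)]
  simp

/-- The coordinate `t`. -/
noncomputable def ct : SmoothFn := ofReal (fun p ↦ p.1) contDiff_fst
/-- The coordinate `x₁`. -/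
noncomputable def cx : SmoothFn := ofReal (fun p ↦ p.2.1) (contDiff_fst.comp contDiff_snd)
/-- The coordinate `x₂`. -/
noncomputable def cy : SmoothFn := ofReal (fun p ↦ p.2.2) (contDiff_snd.comp contDiff_snd)
/-- The constant function `i`. -/
noncomputable def ci : SmoothFn := algebraMap ℂ SmoothFn Complex.I
/-- The complex coordinate `z = x₁ + i x₂`. -/
noncomputable def cz : SmoothFn := cx + ci * cy
/-- The complex coordinate `z̄ = x₁ - i x₂`. -/
noncomputable def cw : SmoothFn := cx - ci * cy

@[simp] theorem ct_apply (p : ℝ × ℝ × ℝ) : ct p = (p.1 : ℂ) := rfl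
@[simp] theorem cx_apply (p : ℝ × ℝ × ℝ) : cx p = (p.2.1 : ℂ) := rfl
@[simp] theorem cy_apply (p : ℝ × ℝ × ℝ) : cy p = (p.2.2 : ℂ) := rfl
@[simp] theorem ci_apply (p : ℝ × ℝ × ℝ) : ci p = Complex.I := rfl

theorem ci_mul_ci : ci * ci = -1 := by ext p; simp

/-- `∂_t`. -/
noncomputable def dT : Derivation ℂ SmoothFn SmoothFn := pd (1, 0, 0)
/-- `∂_{x₁}`. -/
noncomputable def dX : Derivation ℂ SmoothFn SmoothFn := pd (0, 1, 0)
/-- `∂_{x₂}`. -/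
noncomputable def dY : Derivation ℂ SmoothFn SmoothFn := pd (0, 0, 1)
/-- The Wirtinger derivative `∂_z`. -/
noncomputable def dZ : Derivation ℂ SmoothFn SmoothFn := (1 / 2 : ℂ) • (dX - ci • dY)
/-- The Wirtinger derivative `∂_z̄`. -/
noncomputable def dW : Derivation ℂ SmoothFn SmoothFn := (1 / 2 : ℂ) • (dX + ci • dY)

theorem dZ_eq (f : SmoothFn) : dZ f = (1 / 2 : ℂ) • (dX f - ci * dY f) := rfl
theorem dW_eq (f : SmoothFn) : dW f = (1 / 2 : ℂ) • (dX f + ci * dY f) := rfl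

theorem dX_eq (f : SmoothFn) : dX f = dZ f + dW f := by
  ext p; simp [dZ_eq, dW_eq]; ring

theorem ci_mul_dY_eq (f : SmoothFn) : ci * dY f = dW f - dZ f := by
  ext p; simp [dZ_eq, dW_eq]; ring

theorem dY_eq (f : SmoothFn) : dY f = ci * (dZ f - dW f) := by
  have := ci_mul_dY_eq f
  linear_combination (-ci) * this + dY f * ci_mul_ci

@[simp] theorem dT_ct : dT ct = 1 := by
  ext p; rw [dT, ct, pd_ofReal]; simp [fderiv_fst]
@[simp] theorem dT_cx : dT cx = 0 := by
  ext p; rw [dT, cx, pd_ofReal]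
  rw [show (fun p : ℝ × ℝ × ℝ ↦ p.2.1) = (ContinuousLinearMap.fst ℝ ℝ ℝ).comp
    (ContinuousLinearMap.snd ℝ ℝ (ℝ × ℝ)) from rfl, ContinuousLinearMap.fderiv]; simp
@[simp] theorem dT_cy : dT cy = 0 := by
  ext p; rw [dT, cy, pd_ofReal]
  rw [show (fun p : ℝ × ℝ × ℝ ↦ p.2.2) = (ContinuousLinearMap.snd ℝ ℝ ℝ).comp
    (ContinuousLinearMap.snd ℝ ℝ (ℝ × ℝ)) from rfl, ContinuousLinearMap.fderiv]; simp
@[simp] theorem dX_ct : dX ct = 0 := by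
  ext p; rw [dX, ct, pd_ofReal]; simp [fderiv_fst]
@[simp] theorem dX_cx : dX cx = 1 := by
  ext p; rw [dX, cx, pd_ofReal]
  rw [show (fun p : ℝ × ℝ × ℝ ↦ p.2.1) = (ContinuousLinearMap.fst ℝ ℝ ℝ).comp
    (ContinuousLinearMap.snd ℝ ℝ (ℝ × ℝ)) from rfl, ContinuousLinearMap.fderiv]; simp
@[simp] theorem dX_cy : dX cy = 0 := by
  ext p; rw [dX, cy, pd_ofReal]
  rw [show (fun p : ℝ × ℝ × ℝ ↦ p.2.2) = (ContinuousLinearMap.snd ℝ ℝ ℝ).comp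
    (ContinuousLinearMap.snd ℝ ℝ (ℝ × ℝ)) from rfl, ContinuousLinearMap.fderiv]; simp
@[simp] theorem dY_ct : dY ct = 0 := by
  ext p; rw [dY, ct, pd_ofReal]; simp [fderiv_fst]
@[simp] theorem dY_cx : dY cx = 0 := by
  ext p; rw [dY, cx, pd_ofReal]
  rw [show (fun p : ℝ × ℝ × ℝ ↦ p.2.1) = (ContinuousLinearMap.fst ℝ ℝ ℝ).comp
    (ContinuousLinearMap.snd ℝ ℝ (ℝ × ℝ)) from rfl, ContinuousLinearMap.fderiv]; simp
@[simp] theorem dY_cy : dY cy = 1 := by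
  ext p; rw [dY, cy, pd_ofReal]
  rw [show (fun p : ℝ × ℝ × ℝ ↦ p.2.2) = (ContinuousLinearMap.snd ℝ ℝ ℝ).comp
    (ContinuousLinearMap.snd ℝ ℝ (ℝ × ℝ)) from rfl, ContinuousLinearMap.fderiv]; simp

@[simp] theorem derivation_ci (D : Derivation ℂ SmoothFn SmoothFn) : D ci = 0 :=
  D.map_algebraMap _

@[simp] theorem dT_cz : dT cz = 0 := by simp [cz]
@[simp] theorem dT_cw : dT cw = 0 := by simp [cw]
@[simp] theorem dZ_ct : dZ ct = 0 := by simp [dZ_eq]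
@[simp] theorem dW_ct : dW ct = 0 := by simp [dW_eq]
@[simp] theorem dZ_cz : dZ cz = 1 := by
  ext p; simp [dZ_eq, cz]; norm_num
@[simp] theorem dZ_cw : dZ cw = 0 := by
  ext p; simp [dZ_eq, cw]
@[simp] theorem dW_cz : dW cz = 0 := by
  ext p; simp [dW_eq, cz]
@[simp] theorem dW_cw : dW cw = 1 := by
  ext p; simp [dW_eq, cw]; norm_num

theorem derivation_four (D : Derivation ℂ SmoothFn SmoothFn) : D 4 = 0 := D.map_natCast 4

theorem dX_dT (f : SmoothFn) : dX (dT f) = dT (dX f) := pd_comm _ _ f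
theorem dY_dT (f : SmoothFn) : dY (dT f) = dT (dY f) := pd_comm _ _ f
theorem dY_dX (f : SmoothFn) : dY (dX f) = dX (dY f) := pd_comm _ _ f

theorem dZ_dT (f : SmoothFn) : dZ (dT f) = dT (dZ f) := by
  simp [dZ_eq, dX_dT, dY_dT]
theorem dW_dT (f : SmoothFn) : dW (dT f) = dT (dW f) := by
  simp [dW_eq, dX_dT, dY_dT]
theorem dW_dZ (f : SmoothFn) : dW (dZ f) = dZ (dW f) := by
  ext p; simp [dW_eq, dZ_eq, dY_dX]; ring

theorem four_mul_dZ_dW (f : SmoothFn) : 4 * dZ (dW f) = dX (dX f) + dY (dY f) := by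
  ext p; simp [dW_eq, dZ_eq, dY_dX]; linear_combination (- dY (dY f) p) * Complex.I_mul_I

/-- The operator `z ∂_z - z̄ ∂_z̄ + m`, that is, `-i ∂_θ + m`. -/
noncomputable def angN (m : ℤ) (f : SmoothFn) : SmoothFn := cz * dZ f - cw * dW f + m * f

/-- The conjugated Hanges operator `∂_t² + t² Δ + (∂_θ + i m)²`. -/
noncomputable def hangesOp (m : ℤ) (f : SmoothFn) : SmoothFn :=
  dT (dT f) + ct ^ 2 * (4 * dZ (dW f)) - angN m (angN m f)

theorem angN_eq (m : ℤ) (f : SmoothFn) :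
    angN m f = m * f - ci * (cx * dY f - cy * dX f) := by
  rw [angN, cz, cw, dX_eq, dY_eq]
  linear_combination (cx * (dZ f - dW f)) * ci_mul_ci

theorem dZ_angN (m : ℤ) (f : SmoothFn) : dZ (angN m f) = angN (m + 1) (dZ f) := by
  simp [angN, dW_dZ]; ring

theorem dW_angN (m : ℤ) (f : SmoothFn) : dW (angN m f) = angN (m - 1) (dW f) := by
  simp [angN, dW_dZ]; ring

theorem dT_angN (m : ℤ) (f : SmoothFn) : dT (angN m f) = angN m (dT f) := by
  simp [angN, dW_dT, dZ_dT]

theorem dZ_hangesOp (m : ℤ) (f : SmoothFn) : dZ (hangesOp m f) = hangesOp (m + 1) (dZ f) := by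
  rw [hangesOp, hangesOp, map_sub, map_add, dZ_angN, dZ_angN, Derivation.leibniz,
    Derivation.leibniz, Derivation.leibniz_pow, ← dW_dZ, dZ_dT, dZ_dT]
  simp [derivation_four]

theorem dW_hangesOp (m : ℤ) (f : SmoothFn) : dW (hangesOp m f) = hangesOp (m - 1) (dW f) := by
  rw [hangesOp, hangesOp, map_sub, map_add, dW_angN, dW_angN, Derivation.leibniz,
    Derivation.leibniz, Derivation.leibniz_pow, dW_dZ, dW_dT, dW_dT]
  simp [derivation_four]

instance : (volume : Measure (ℝ × ℝ × ℝ)).IsAddHaarMeasure := by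
  rw [Measure.volume_eq_prod, Measure.volume_eq_prod]
  have h : ((volume : Measure ℝ).prod (volume : Measure ℝ)).IsAddHaarMeasure :=
    Measure.prod.instIsAddHaarMeasure _ _
  exact Measure.prod.instIsAddHaarMeasure _ _

theorem integral_sub_sub {α : Type*} [MeasurableSpace α] {μ : Measure α} {f g h : α → ℝ}
    (hf : Integrable f μ) (hg : Integrable g μ) (hh : Integrable h μ) (a b c : ℝ) :
    ∫ p, (a * f p - b * g p - c * h p) ∂μ =
      a * ∫ p, f p ∂μ - b * ∫ p, g p ∂μ - c * ∫ p, h p ∂μ := by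
  rw [integral_sub (f := fun p ↦ a * f p - b * g p)
    ((hf.const_mul a).sub (hg.const_mul b)) (hh.const_mul c),
    integral_sub (hf.const_mul a) (hg.const_mul b), integral_const_mul, integral_const_mul,
    integral_const_mul]

theorem integral_pd_eq_zero (e : ℝ × ℝ × ℝ) (f : SmoothFn) (hf : HasCompactSupport f) :
    ∫ p, pd e f p = 0 := by
  have hg : HasCompactSupport (pd e f) := by
    refine hf.mono' fun p hp ↦ ?_
    by_contra h
    refine hp ?_
    have : fderiv ℝ f p = 0 := by
      by_contra h'
      exact h (support_fderiv_subset ℝ h')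
    rw [pd_apply, this]; rfl
  have := integral_mul_fderiv_eq_neg_fderiv_mul_of_integrable (μ := volume) (𝕜 := ℂ)
    (f := fun _ : ℝ × ℝ × ℝ ↦ (1 : ℂ)) (g := f) (v := e) (by simp)
    (by simp only [one_mul]; exact (continuous (pd e f)).integrable_of_hasCompactSupport hg)
    (by simpa using (continuous f).integrable_of_hasCompactSupport hf)
    (by simp) (fun p _ ↦ differentiable f p)
  simp only [one_mul] at this
  refine this.trans ?_
  simp

theorem energy_identity (Ψ N : SmoothFn) (hT : dT Ψ = ct * N) (hX : dX Ψ = cx * N)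
    (hY : dY Ψ = cy * N) (m : ℤ) (v : SmoothFn) :
    16 * (dT (Ψ ^ 2 * conj v * dT v) + dX (Ψ ^ 2 * ct ^ 2 * conj v * dX v)
      + dY (Ψ ^ 2 * ct ^ 2 * conj v * dY v)
      + ci * (dY (cx * Ψ ^ 2 * conj v * angN m v) - dX (cy * Ψ ^ 2 * conj v * angN m v)))
      + dT (ct * Ψ ^ 2 * conj v * v) =
    16 * (Ψ ^ 2 * (conj v * hangesOp m v)
      + Ψ ^ 2 * (conj (angN m v) * angN m v + conj (dT v) * dT v
        + ct ^ 2 * (conj (dX v) * dX v + conj (dY v) * dY v))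
      + 2 * (Ψ * N * (conj v * (ct * dT v + ct ^ 2 * (cx * dX v + cy * dY v)))))
      + Ψ ^ 2 * (conj v * v) + 2 * (Ψ * N * (ct ^ 2 * (conj v * v)))
      + ct * (Ψ ^ 2 * (conj (dT v) * v + conj v * dT v)) := by
  have hw : conj (angN m v) = m * conj v + ci * (cx * dY (conj v) - cy * dX (conj v)) := by
    rw [angN_eq]
    ext p
    simp [dX, dY, pd_conj]
  have hTc : dT (conj v) = conj (dT v) := pd_conj _ v
  have hXc : dX (conj v) = conj (dX v) := pd_conj _ v
  have hYc : dY (conj v) = conj (dY v) := pd_conj _ v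
  rw [hw, hangesOp, four_mul_dZ_dW, angN_eq m (angN m v), ← hTc, ← hXc, ← hYc]
  generalize angN m v = w
  generalize conj v = c
  simp only [Derivation.leibniz, Derivation.leibniz_pow, hT, hX, hY, dT_ct, dX_ct, dY_ct,
    dX_cy, dY_cx, smul_eq_mul, nsmul_eq_mul]
  push_cast
  ring

theorem re_conj_mul_ge (a b : ℂ) (c d : ℝ) :
    -(c ^ 2 * ‖b‖ ^ 2 + d ^ 2 * ‖a‖ ^ 2) ≤ 2 * c * d * (a.re * b.re + a.im * b.im) := by
  rw [Complex.sq_norm, Complex.sq_norm, Complex.normSq_apply, Complex.normSq_apply]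
  nlinarith [sq_nonneg (d * a.re + c * b.re), sq_nonneg (d * a.im + c * b.im)]

theorem energy_inequality {ψ ν : ℝ × ℝ × ℝ → ℝ} (hψ : ContDiff ℝ ∞ ψ) (hν : ContDiff ℝ ∞ ν)
    (hψc : HasCompactSupport ψ) (hνc : HasCompactSupport ν)
    (hT : dT (ofReal ψ hψ) = ct * ofReal ν hν) (hX : dX (ofReal ψ hψ) = cx * ofReal ν hν)
    (hY : dY (ofReal ψ hψ) = cy * ofReal ν hν)
    (hsupp : ∀ p, (p.1 ^ 2 ≤ 1 ∧ p.2.1 ^ 2 + p.2.2 ^ 2 ≤ 1) ∨ (ψ p = 0 ∧ ν p = 0))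
    (m : ℤ) (v : SmoothFn) :
    ∫ p, ψ p ^ 2 * (‖dT v p‖ ^ 2 + p.1 ^ 2 * (‖dX v p‖ ^ 2 + ‖dY v p‖ ^ 2) + ‖v p‖ ^ 2 / 32) ≤
      25 * (∫ p, ν p ^ 2 * (p.1 ^ 2 * ‖v p‖ ^ 2)) +
      32 * ∫ p, ψ p ^ 2 * ‖hangesOp m v p‖ ^ 2 := by
  set Ψ := ofReal ψ hψ with hΨ
  set N := ofReal ν hν with hN
  have hcs (f : SmoothFn) (g : SmoothFn) (hf : HasCompactSupport (f : ℝ × ℝ × ℝ → ℂ)) :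
      HasCompactSupport ((f * g : SmoothFn) : ℝ × ℝ × ℝ → ℂ) := HasCompactSupport.mul_right hf
  have hΨc : HasCompactSupport (Ψ : ℝ × ℝ × ℝ → ℂ) :=
    hψc.comp_left (g := fun x : ℝ ↦ (x : ℂ)) (by simp)
  have hdiv (e : ℝ × ℝ × ℝ) (g : SmoothFn) : (∫ p, pd e (Ψ * g) p = 0) ∧
      Integrable (pd e (Ψ * g) : ℝ × ℝ × ℝ → ℂ) := by
    refine ⟨integral_pd_eq_zero _ _ (hcs _ _ hΨc), ?_⟩
    refine (continuous _).integrable_of_hasCompactSupport ?_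
    exact ((hcs Ψ g hΨc).fderiv (𝕜 := ℝ)).comp_left (g := fun L : ℝ × ℝ × ℝ →L[ℝ] ℂ ↦ L e) (by simp)
  set R := 16 * (Ψ ^ 2 * (conj v * hangesOp m v)
      + Ψ ^ 2 * (conj (angN m v) * angN m v + conj (dT v) * dT v
        + ct ^ 2 * (conj (dX v) * dX v + conj (dY v) * dY v))
      + 2 * (Ψ * N * (conj v * (ct * dT v + ct ^ 2 * (cx * dX v + cy * dY v)))))
      + Ψ ^ 2 * (conj v * v) + 2 * (Ψ * N * (ct ^ 2 * (conj v * v)))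
      + ct * (Ψ ^ 2 * (conj (dT v) * v + conj v * dT v)) with hR
  have hid := energy_identity Ψ N hT hX hY m v
  rw [← hR] at hid
  have hRint : (∫ p, R p = 0) ∧ Integrable (R : ℝ × ℝ × ℝ → ℂ) := by
    have h1 := hdiv (1, 0, 0) (Ψ * conj v * dT v)
    have h2 := hdiv (0, 1, 0) (Ψ * ct ^ 2 * conj v * dX v)
    have h3 := hdiv (0, 0, 1) (Ψ * ct ^ 2 * conj v * dY v)
    have h4 := hdiv (0, 0, 1) (cx * Ψ * conj v * angN m v)
    have h5 := hdiv (0, 1, 0) (cy * Ψ * conj v * angN m v)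
    have h6 := hdiv (1, 0, 0) (ct * Ψ * conj v * v)
    have hRp : (R : ℝ × ℝ × ℝ → ℂ) = fun p ↦
        16 * (pd (1, 0, 0) (Ψ * (Ψ * conj v * dT v)) p
          + pd (0, 1, 0) (Ψ * (Ψ * ct ^ 2 * conj v * dX v)) p
          + pd (0, 0, 1) (Ψ * (Ψ * ct ^ 2 * conj v * dY v)) p
          + Complex.I * (pd (0, 0, 1) (Ψ * (cx * Ψ * conj v * angN m v)) p
            - pd (0, 1, 0) (Ψ * (cy * Ψ * conj v * angN m v)) p))
          + pd (1, 0, 0) (Ψ * (ct * Ψ * conj v * v)) p := by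
      rw [← hid]
      funext p
      rw [show Ψ * (Ψ * conj v * dT v) = Ψ ^ 2 * conj v * dT v by ring,
        show Ψ * (Ψ * ct ^ 2 * conj v * dX v) = Ψ ^ 2 * ct ^ 2 * conj v * dX v by ring,
        show Ψ * (Ψ * ct ^ 2 * conj v * dY v) = Ψ ^ 2 * ct ^ 2 * conj v * dY v by ring,
        show Ψ * (cx * Ψ * conj v * angN m v) = cx * Ψ ^ 2 * conj v * angN m v by ring,
        show Ψ * (cy * Ψ * conj v * angN m v) = cy * Ψ ^ 2 * conj v * angN m v by ring,
        show Ψ * (ct * Ψ * conj v * v) = ct * Ψ ^ 2 * conj v * v by ring]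
      rfl
    have hadd {f g : ℝ × ℝ × ℝ → ℂ} (hf : (∫ p, f p = 0) ∧ Integrable f)
        (hg : (∫ p, g p = 0) ∧ Integrable g) :
        (∫ p, (f p + g p) = 0) ∧ Integrable fun p ↦ f p + g p :=
      ⟨by rw [integral_add hf.2 hg.2, hf.1, hg.1, add_zero], hf.2.add hg.2⟩
    have hsub {f g : ℝ × ℝ × ℝ → ℂ} (hf : (∫ p, f p = 0) ∧ Integrable f)
        (hg : (∫ p, g p = 0) ∧ Integrable g) :
        (∫ p, (f p - g p) = 0) ∧ Integrable fun p ↦ f p - g p :=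
      ⟨by rw [integral_sub hf.2 hg.2, hf.1, hg.1, sub_zero], hf.2.sub hg.2⟩
    have hmul {f : ℝ × ℝ × ℝ → ℂ} (c : ℂ) (hf : (∫ p, f p = 0) ∧ Integrable f) :
        (∫ p, c * f p = 0) ∧ Integrable fun p ↦ c * f p :=
      ⟨by rw [integral_const_mul, hf.1, mul_zero], hf.2.const_mul c⟩
    rw [hRp]
    exact hadd (hmul 16 (hadd (hadd (hadd h1 h2) h3) (hmul Complex.I (hsub h4 h5)))) h6
  have hRre : ∫ p, (R p).re = 0 := by
    have := integral_re (𝕜 := ℂ) hRint.2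
    rw [hRint.1] at this
    simpa using this
  have hcψ := hψ.continuous
  have hcν := hν.continuous
  have hsq (f : ℝ × ℝ × ℝ → ℝ) (hf : HasCompactSupport f) (hfc : Continuous f)
      (g : ℝ × ℝ × ℝ → ℝ) (hg : Continuous g) : Integrable (fun p ↦ f p ^ 2 * g p) := by
    refine Continuous.integrable_of_hasCompactSupport (by fun_prop) ?_
    exact HasCompactSupport.mul_right (hf.comp_left (g := fun x : ℝ ↦ x ^ 2) (by simp))
  have c0 := continuous v
  have c1 := continuous (dT v)
  have c2 := continuous (dX v)
  have c3 := continuous (dY v)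
  have c4 := continuous (hangesOp m v)
  have I1 := hsq ψ hψc hcψ (fun p ↦ ‖dT v p‖ ^ 2 + p.1 ^ 2 * (‖dX v p‖ ^ 2 + ‖dY v p‖ ^ 2)
    + ‖v p‖ ^ 2 / 32) (by fun_prop)
  have I2 := hsq ν hνc hcν (fun p ↦ p.1 ^ 2 * ‖v p‖ ^ 2) (by fun_prop)
  have I3 := hsq ψ hψc hcψ (fun p ↦ ‖hangesOp m v p‖ ^ 2) (by fun_prop)
  have hpt : ∀ p, 8 * (ψ p ^ 2 * (‖dT v p‖ ^ 2 + p.1 ^ 2 * (‖dX v p‖ ^ 2 + ‖dY v p‖ ^ 2)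
      + ‖v p‖ ^ 2 / 32)) - 200 * (ν p ^ 2 * (p.1 ^ 2 * ‖v p‖ ^ 2))
      - 256 * (ψ p ^ 2 * ‖hangesOp m v p‖ ^ 2) ≤ (R p).re := by
    intro p
    have hΨp : Ψ p = (ψ p : ℂ) := rfl
    have hNp : N p = (ν p : ℂ) := rfl
    rcases hsupp p with ⟨ht, hxy⟩ | ⟨h0, h0'⟩
    swap
    · simp [hR, hΨp, hNp, h0, h0']
    have e (a b : ℂ) : (starRingEnd ℂ a * b).re = a.re * b.re + a.im * b.im := by simp
    have hre : (R p).re = 16 * (ψ p ^ 2 * ((v p).re * (hangesOp m v p).re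
          + (v p).im * (hangesOp m v p).im)
        + ψ p ^ 2 * (‖angN m v p‖ ^ 2 + ‖dT v p‖ ^ 2
          + p.1 ^ 2 * (‖dX v p‖ ^ 2 + ‖dY v p‖ ^ 2))
        + 2 * (ψ p * ν p * (p.1 * ((v p).re * (dT v p).re + (v p).im * (dT v p).im)
          + p.1 ^ 2 * (p.2.1 * ((v p).re * (dX v p).re + (v p).im * (dX v p).im)
            + p.2.2 * ((v p).re * (dY v p).re + (v p).im * (dY v p).im)))))
        + ψ p ^ 2 * ‖v p‖ ^ 2 + 2 * (ψ p * ν p * (p.1 ^ 2 * ‖v p‖ ^ 2))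
        + 2 * (p.1 * ψ p ^ 2) * ((v p).re * (dT v p).re + (v p).im * (dT v p).im) := by
      have ns (a : ℂ) : ‖a‖ ^ 2 = a.re * a.re + a.im * a.im := by
        rw [Complex.sq_norm, Complex.normSq_apply]
      simp only [ns]
      simp only [hR, add_apply, mul_apply, ofNat_apply, conj_apply, hΨp, hNp, ct_apply,
        cx_apply, cy_apply, pow_two, Complex.add_re,
        Complex.mul_re, Complex.mul_im, Complex.add_im, Complex.ofReal_re, Complex.ofReal_im,
        Complex.conj_re, Complex.conj_im, Complex.re_ofNat, Complex.im_ofNat]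
      ring
    rw [hre]
    have q1 := re_conj_mul_ge (v p) (hangesOp m v p) (16 * ψ p) (ψ p / 2)
    have q2 := re_conj_mul_ge (v p) (dT v p) (2 * ψ p) (8 * (ν p * p.1))
    have q3 := re_conj_mul_ge (v p) (dX v p) (2 * (ψ p * p.1)) (8 * (ν p * p.1 * p.2.1))
    have q4 := re_conj_mul_ge (v p) (dY v p) (2 * (ψ p * p.1)) (8 * (ν p * p.1 * p.2.2))
    have q5 := re_conj_mul_ge (v p) (dT v p) (2 * ψ p) (ψ p * p.1 / 2)
    have q6 := mul_nonneg (sq_nonneg (ψ p / 2 + 2 * (ν p * p.1 ^ 2))) (sq_nonneg ‖v p‖)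
    have q7 : 0 ≤ ψ p ^ 2 * ‖v p‖ ^ 2 * (1 - p.1 ^ 2) :=
      mul_nonneg (by positivity) (by linarith)
    have q8 : 0 ≤ ν p ^ 2 * p.1 ^ 2 * ‖v p‖ ^ 2 * (1 - p.1 ^ 2) :=
      mul_nonneg (by positivity) (by linarith)
    have q9 : 0 ≤ ν p ^ 2 * p.1 ^ 2 * ‖v p‖ ^ 2 * (1 - (p.2.1 ^ 2 + p.2.2 ^ 2)) :=
      mul_nonneg (by positivity) (by linarith)
    have q10 : 0 ≤ ψ p ^ 2 * ‖angN m v p‖ ^ 2 := by positivity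
    have q11 : 0 ≤ ψ p ^ 2 * (p.1 ^ 2 * ‖dX v p‖ ^ 2) := by positivity
    have q12 : 0 ≤ ψ p ^ 2 * (p.1 ^ 2 * ‖dY v p‖ ^ 2) := by positivity
    have q13 : 0 ≤ ν p ^ 2 * p.1 ^ 2 * ‖v p‖ ^ 2 := by positivity
    linarith
  have := integral_mono (((I1.const_mul 8).sub (I2.const_mul 200)).sub (I3.const_mul 256))
    (hRint.2.re) hpt
  have h0 : ∫ p, RCLike.re (R p) = 0 := hRre
  rw [h0] at this
  have h1 := integral_sub_sub I1 I2 I3 8 200 256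
  simp only [Pi.sub_apply] at this
  rw [h1] at this
  linarith

/-- A smooth radial cutoff function `bump`, with `d bump = slope (t dt + x dx + y dy)`, which is `1`
on the ball of squared radius `ρ` and vanishes off the ball of squared radius `2 ρ`. -/
structure RadialCutoff (ρ : ℝ) where
  bump : ℝ × ℝ × ℝ → ℝ
  slope : ℝ × ℝ × ℝ → ℝ
  contDiff_bump : ContDiff ℝ ∞ bump
  contDiff_slope : ContDiff ℝ ∞ slope
  dT_bump : dT (ofReal bump contDiff_bump) = ct * ofReal slope contDiff_slope
  dX_bump : dX (ofReal bump contDiff_bump) = cx * ofReal slope contDiff_slope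
  dY_bump : dY (ofReal bump contDiff_bump) = cy * ofReal slope contDiff_slope
  nonneg : ∀ p, 0 ≤ bump p
  le_one : ∀ p, bump p ≤ 1
  eq_one : ∀ p, p.1 ^ 2 + p.2.1 ^ 2 + p.2.2 ^ 2 ≤ ρ → bump p = 1
  bump_eq_zero : ∀ p, 2 * ρ ≤ p.1 ^ 2 + p.2.1 ^ 2 + p.2.2 ^ 2 → bump p = 0
  slope_eq_zero : ∀ p, 2 * ρ ≤ p.1 ^ 2 + p.2.1 ^ 2 + p.2.2 ^ 2 → slope p = 0

theorem hasCompactSupport_of_eq_zero {f : ℝ × ℝ × ℝ → ℝ} {ρ : ℝ}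
    (h : ∀ p, ρ ≤ p.1 ^ 2 + p.2.1 ^ 2 + p.2.2 ^ 2 → f p = 0) : HasCompactSupport f := by
  refine HasCompactSupport.intro (isCompact_closedBall 0 (Real.sqrt ρ)) fun p hp ↦ h p ?_
  by_contra! h'
  apply hp
  rw [mem_closedBall_zero_iff]
  have e (x : ℝ) (hx : x ^ 2 ≤ p.1 ^ 2 + p.2.1 ^ 2 + p.2.2 ^ 2) : ‖x‖ ≤ Real.sqrt ρ :=
    Real.abs_le_sqrt (hx.trans h'.le)
  refine norm_prod_le_iff.2 ⟨e _ ?_, norm_prod_le_iff.2 ⟨e _ ?_, e _ ?_⟩⟩ <;>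
    nlinarith [sq_nonneg p.1, sq_nonneg p.2.1, sq_nonneg p.2.2]

theorem RadialCutoff.nonempty {ρ : ℝ} (hρ : 0 < ρ) : Nonempty (RadialCutoff ρ) := by
  let q : ℝ × ℝ × ℝ → ℝ := fun p ↦ p.1 ^ 2 + p.2.1 ^ 2 + p.2.2 ^ 2
  have hq : ContDiff ℝ ∞ q := by fun_prop
  have hqe : ofReal q hq = ct ^ 2 + cx ^ 2 + cy ^ 2 := by
    ext p; simp [q]
  let g : ℝ → ℝ := fun s ↦ Real.smoothTransition (2 - s / ρ)
  have hg : ContDiff ℝ ∞ g := Real.smoothTransition.contDiff.comp (by fun_prop)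
  have hg' : ContDiff ℝ ∞ (deriv g) := by
    have := (contDiff_infty_iff_deriv (𝕜 := ℝ) (f := g)).1 hg
    exact this.2
  have hslope : ContDiff ℝ ∞ fun p ↦ 2 * deriv g (q p) := contDiff_const.mul (hg'.comp hq)
  have hd (e : ℝ × ℝ × ℝ) (c : SmoothFn) (hc : pd e (ofReal q hq) = 2 * c) :
      pd e (ofReal (fun p ↦ g (q p)) (hg.comp hq)) = c * ofReal _ hslope := by
    ext p
    have h1 := congrArg (fun f : SmoothFn ↦ f p) hc
    simp only [pd_ofReal, mul_apply, ofNat_apply] at h1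
    rw [pd_ofReal]
    have h2 : fderiv ℝ (fun p ↦ g (q p)) p e = deriv g (q p) * fderiv ℝ q p e := by
      have hh := (hg.differentiable (by simp) (q p)).hasDerivAt.comp_hasFDerivAt p
        (hq.differentiable (by simp) p).hasFDerivAt
      have := hh.fderiv
      rw [show (fun p ↦ g (q p)) = g ∘ q from rfl, this]
      simp
    rw [h2]
    push_cast
    rw [h1]
    change _ = c p * ((2 * deriv g (q p) : ℝ) : ℂ)
    push_cast
    ring
  have hz : ∀ s, 2 * ρ ≤ s → g s = 0 := fun s hs ↦ by
    apply Real.smoothTransition.zero_of_nonpos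
    have : 2 ≤ s / ρ := by rwa [le_div_iff₀ hρ]
    linarith
  refine ⟨⟨fun p ↦ g (q p), fun p ↦ 2 * deriv g (q p), hg.comp hq, hslope, hd _ _ ?_, hd _ _ ?_,
    hd _ _ ?_, fun p ↦ Real.smoothTransition.nonneg _, fun p ↦ Real.smoothTransition.le_one _,
    fun p hp ↦ ?_, fun p hp ↦ hz _ hp, fun p hp ↦ ?_⟩⟩
  · rw [hqe]; change dT _ = _; simp [Derivation.leibniz_pow]
  · rw [hqe]; change dX _ = _; simp [Derivation.leibniz_pow]
  · rw [hqe]; change dY _ = _; simp [Derivation.leibniz_pow]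
  · apply Real.smoothTransition.one_of_one_le
    have : q p / ρ ≤ 1 := by rwa [div_le_one hρ]
    linarith
  · have : IsLocalMin g (q p) := Filter.Eventually.of_forall fun s ↦ by
      rw [hz _ hp]; exact Real.smoothTransition.nonneg _
    simp [this.deriv_eq_zero]

namespace RadialCutoff

variable {ρ : ℝ} (χ : RadialCutoff ρ)

theorem hasCompactSupport_bump : HasCompactSupport χ.bump :=
  hasCompactSupport_of_eq_zero χ.bump_eq_zero

theorem hasCompactSupport_slope : HasCompactSupport χ.slope :=
  hasCompactSupport_of_eq_zero χ.slope_eq_zero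

theorem exists_bound_slope : ∃ K : ℝ, 0 ≤ K ∧ ∀ p, |χ.slope p| ≤ K := by
  obtain ⟨K, hK⟩ :=
    χ.contDiff_slope.continuous.bounded_above_of_compact_support χ.hasCompactSupport_slope
  exact ⟨K, (norm_nonneg _).trans (hK 0), hK⟩

/-- The weighted energy of a smooth function. -/
noncomputable def energy (k : ℕ) (v : SmoothFn) : ℝ :=
  ∫ p, (χ.bump p ^ (k + 1)) ^ 2 *
    (‖dT v p‖ ^ 2 + p.1 ^ 2 * (‖dX v p‖ ^ 2 + ‖dY v p‖ ^ 2) + ‖v p‖ ^ 2 / 32)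

theorem integrable_bump_pow (k : ℕ) {g : ℝ × ℝ × ℝ → ℝ} (hg : Continuous g) :
    Integrable fun p ↦ (χ.bump p ^ (k + 1)) ^ 2 * g p := by
  have := χ.contDiff_bump.continuous
  refine Continuous.integrable_of_hasCompactSupport (by fun_prop) ?_
  exact HasCompactSupport.mul_right
    (χ.hasCompactSupport_bump.comp_left (g := fun x : ℝ ↦ (x ^ (k + 1)) ^ 2) (by simp))

theorem continuous_energy (v : SmoothFn) : Continuous fun p : ℝ × ℝ × ℝ ↦
    ‖dT v p‖ ^ 2 + p.1 ^ 2 * (‖dX v p‖ ^ 2 + ‖dY v p‖ ^ 2) + ‖v p‖ ^ 2 / 32 := by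
  have c0 := continuous v
  have c1 := continuous (dT v)
  have c2 := continuous (dX v)
  have c3 := continuous (dY v)
  fun_prop

theorem energy_nonneg (k : ℕ) (v : SmoothFn) : 0 ≤ χ.energy k v :=
  integral_nonneg fun p ↦ by positivity

theorem energy_step (hρ : 2 * ρ ≤ 1) {K : ℝ} (hK : ∀ p, |χ.slope p| ≤ K) (k : ℕ) (m : ℤ)
    (v v' : SmoothFn) (h : ∀ p, ‖v p‖ ^ 2 ≤ ‖dX v' p‖ ^ 2 + ‖dY v' p‖ ^ 2) {B : ℝ}
    (hB : ∀ p, χ.bump p ≠ 0 → ‖hangesOp m v p‖ ≤ B) :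
    χ.energy (k + 1) v ≤ 25 * K ^ 2 * (k + 2) ^ 2 * χ.energy k v' +
      32 * B ^ 2 * ∫ p, (χ.bump p ^ (0 + 1)) ^ 2 * 1 := by
  have hψ : ContDiff ℝ ∞ fun p ↦ χ.bump p ^ (k + 2) := χ.contDiff_bump.pow _
  have hν : ContDiff ℝ ∞ fun p ↦ (k + 2 : ℝ) * χ.bump p ^ (k + 1) * χ.slope p :=
    (contDiff_const.mul (χ.contDiff_bump.pow _)).mul χ.contDiff_slope
  have e1 : ofReal _ hψ = ofReal χ.bump χ.contDiff_bump ^ (k + 2) := by ext p; simp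
  have e2 : ofReal _ hν = (k + 2 : SmoothFn) * ofReal χ.bump χ.contDiff_bump ^ (k + 1)
      * ofReal χ.slope χ.contDiff_slope := by ext p; simp
  have hd (D : Derivation ℂ SmoothFn SmoothFn) (c : SmoothFn)
      (h : D (ofReal χ.bump χ.contDiff_bump) = c * ofReal χ.slope χ.contDiff_slope) :
      D (ofReal _ hψ) = c * ofReal _ hν := by
    rw [e1, e2, Derivation.leibniz_pow, h]
    simp only [smul_eq_mul, nsmul_eq_mul]
    push_cast
    ring
  have key := energy_inequality hψ hν
    (χ.hasCompactSupport_bump.comp_left (g := fun x : ℝ ↦ x ^ (k + 2)) (by simp))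
    (HasCompactSupport.mul_left χ.hasCompactSupport_slope)
    (hd _ _ χ.dT_bump) (hd _ _ χ.dX_bump) (hd _ _ χ.dY_bump) (fun p ↦ ?_) m v
  · refine key.trans (add_le_add ?_ ?_)
    · rw [mul_assoc 25, mul_assoc 25, mul_assoc (K ^ 2)]
      refine mul_le_mul_of_nonneg_left ?_ (by norm_num)
      rw [energy, ← integral_const_mul, ← integral_const_mul]
      refine integral_mono_of_nonneg ?_
        (((χ.integrable_bump_pow k (continuous_energy v')).const_mul _).const_mul _)
        (Filter.Eventually.of_forall fun p ↦ ?_)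
      · exact Filter.Eventually.of_forall fun p ↦ by simp only [Pi.zero_apply]; positivity
      have h1 : χ.slope p ^ 2 ≤ K ^ 2 := sq_le_sq' (neg_le_of_abs_le (hK p)) (le_of_abs_le (hK p))
      have h2 : p.1 ^ 2 * ‖v p‖ ^ 2 ≤ ‖dT v' p‖ ^ 2 + p.1 ^ 2 * (‖dX v' p‖ ^ 2 + ‖dY v' p‖ ^ 2)
          + ‖v' p‖ ^ 2 / 32 := by
        have := mul_le_mul_of_nonneg_left (h p) (sq_nonneg p.1)
        nlinarith [sq_nonneg ‖dT v' p‖, sq_nonneg ‖v' p‖]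
      calc ((k + 2 : ℝ) * χ.bump p ^ (k + 1) * χ.slope p) ^ 2 * (p.1 ^ 2 * ‖v p‖ ^ 2)
          = χ.slope p ^ 2 * ((k + 2 : ℝ) ^ 2 *
            ((χ.bump p ^ (k + 1)) ^ 2 * (p.1 ^ 2 * ‖v p‖ ^ 2))) := by
            ring
        _ ≤ K ^ 2 * ((k + 2 : ℝ) ^ 2 * ((χ.bump p ^ (k + 1)) ^ 2 * (‖dT v' p‖ ^ 2
            + p.1 ^ 2 * (‖dX v' p‖ ^ 2 + ‖dY v' p‖ ^ 2) + ‖v' p‖ ^ 2 / 32))) := by gcongr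
    · rw [mul_assoc 32]
      refine mul_le_mul_of_nonneg_left ?_ (by norm_num)
      rw [← integral_const_mul]
      refine integral_mono_of_nonneg ?_
        ((χ.integrable_bump_pow 0 continuous_const).const_mul _)
        (Filter.Eventually.of_forall fun p ↦ ?_)
      · exact Filter.Eventually.of_forall fun p ↦ by simp only [Pi.zero_apply]; positivity
      change (χ.bump p ^ (k + 2)) ^ 2 * ‖hangesOp m v p‖ ^ 2 ≤
        B ^ 2 * ((χ.bump p ^ (0 + 1)) ^ 2 * 1)
      by_cases h0 : χ.bump p = 0
      · simp [h0]
      · have h1 : (χ.bump p ^ (k + 2)) ≤ χ.bump p ^ (0 + 1) :=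
          pow_le_pow_of_le_one (χ.nonneg p) (χ.le_one p) (by lia)
        have h2 := χ.nonneg p
        rw [mul_one, mul_comm]
        gcongr
        exact hB p h0
  · rcases le_total (2 * ρ) (p.1 ^ 2 + p.2.1 ^ 2 + p.2.2 ^ 2) with h1 | h1
    · right; simp [χ.bump_eq_zero p h1]
    · left
      constructor <;> nlinarith [sq_nonneg p.1, sq_nonneg p.2.1, sq_nonneg p.2.2]

end RadialCutoff

theorem sq_norm_dZ_le (v : SmoothFn) (p : ℝ × ℝ × ℝ) :
    ‖dZ v p‖ ^ 2 ≤ ‖dX v p‖ ^ 2 + ‖dY v p‖ ^ 2 := by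
  have h : dZ v p = (1 / 2) * (dX v p - Complex.I * dY v p) := rfl
  have : ‖dZ v p‖ ≤ 1 / 2 * (‖dX v p‖ + ‖dY v p‖) := by
    rw [h, norm_mul]
    refine mul_le_mul (by simp) ((norm_sub_le _ _).trans (by simp)) (norm_nonneg _) (by norm_num)
  nlinarith [norm_nonneg (dZ v p), norm_nonneg (dX v p), norm_nonneg (dY v p),
    sq_nonneg (‖dX v p‖ - ‖dY v p‖)]

theorem sq_norm_dW_le (v : SmoothFn) (p : ℝ × ℝ × ℝ) :
    ‖dW v p‖ ^ 2 ≤ ‖dX v p‖ ^ 2 + ‖dY v p‖ ^ 2 := by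
  have h : dW v p = (1 / 2) * (dX v p + Complex.I * dY v p) := rfl
  have : ‖dW v p‖ ≤ 1 / 2 * (‖dX v p‖ + ‖dY v p‖) := by
    rw [h, norm_mul]
    refine mul_le_mul (by simp) ((norm_add_le _ _).trans (by simp)) (norm_nonneg _) (by norm_num)
  nlinarith [norm_nonneg (dW v p), norm_nonneg (dX v p), norm_nonneg (dY v p),
    sq_nonneg (‖dX v p‖ - ‖dY v p‖)]

theorem hangesOp_dZ_iterate_dW_iterate (U : SmoothFn) (a b : ℕ) :
    hangesOp (a - b) (dZ^[a] (dW^[b] U)) = dZ^[a] (dW^[b] (hangesOp 0 U)) := by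
  induction a with
  | zero =>
    induction b with
    | zero => simp
    | succ b ih =>
      simp only [Function.iterate_zero, id, Function.iterate_succ', Function.comp_apply] at ih ⊢
      rw [← ih, dW_hangesOp]
      congr 1
      push_cast; ring
  | succ a ih =>
    simp only [Function.iterate_succ', Function.comp_apply]
    rw [← ih, dZ_hangesOp]
    congr 1
    push_cast; ring

theorem RadialCutoff.exists_energy_le {ρ : ℝ} (χ : RadialCutoff ρ) (hρ : 2 * ρ ≤ 1) (U : SmoothFn)
    {A : ℝ} (hA : 0 ≤ A) (hF : ∀ a b p, χ.bump p ≠ 0 →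
      ‖dZ^[a] (dW^[b] (hangesOp 0 U)) p‖ ≤ A ^ (a + b + 1) * (a + b)!) :
    ∃ M : ℝ, 1 ≤ M ∧ ∀ a b,
      χ.energy (a + b) (dZ^[a] (dW^[b] U)) ≤ (M ^ (a + b + 1) * (a + b + 1)!) ^ 2 := by
  obtain ⟨K, hK0, hK⟩ := χ.exists_bound_slope
  set c := 32 * ∫ p, (χ.bump p ^ (0 + 1)) ^ 2 * 1 with hc
  have hc0 : 0 ≤ c := mul_nonneg (by norm_num) (integral_nonneg fun p ↦ by positivity)
  have hE := χ.energy_nonneg 0 U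
  have hcA : 0 ≤ c * A ^ 2 := by positivity
  obtain ⟨M, hM⟩ : ∃ M, M = 1 + A + 5 * K + c * A ^ 2 + χ.energy 0 U := ⟨_, rfl⟩
  have hM1 : 1 ≤ M := by linarith
  have hMA : A ≤ M := by linarith
  have hM2 : 25 * K ^ 2 + c * A ^ 2 ≤ M ^ 2 := by
    have : 1 + 5 * K + c * A ^ 2 ≤ M := by linarith
    nlinarith [mul_nonneg hK0 hcA]
  have hstep (n a b : ℕ) (hab : a + b = n + 1) (v' : SmoothFn)
      (hv' : χ.energy n v' ≤ (M ^ (n + 1) * (n + 1)!) ^ 2)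
      (h : ∀ p, ‖dZ^[a] (dW^[b] U) p‖ ^ 2 ≤ ‖dX v' p‖ ^ 2 + ‖dY v' p‖ ^ 2) :
      χ.energy (n + 1) (dZ^[a] (dW^[b] U)) ≤ (M ^ (n + 2) * (n + 2)!) ^ 2 := by
    have h1 := χ.energy_step hρ hK n (a - b) (dZ^[a] (dW^[b] U)) v' h
      (B := A ^ (n + 2) * (n + 1)!) (fun p hp ↦ by
        rw [hangesOp_dZ_iterate_dW_iterate]
        have := hF a b p hp
        rwa [hab] at this)
    refine h1.trans ?_
    have h2 : A ^ (n + 1) ≤ M ^ (n + 1) := by gcongr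
    have h3 : (((n + 2)! : ℕ) : ℝ) = (n + 2) * (n + 1)! := by
      rw [Nat.factorial_succ (n + 1)]; push_cast; ring
    calc 25 * K ^ 2 * (n + 2) ^ 2 * χ.energy n v' + 32 * (A ^ (n + 2) * (n + 1)!) ^ 2 *
          ∫ p, (χ.bump p ^ (0 + 1)) ^ 2 * 1
        = 25 * K ^ 2 * (n + 2) ^ 2 * χ.energy n v' +
          c * A ^ 2 * (A ^ (n + 1)) ^ 2 * ((n + 1)! : ℝ) ^ 2 * 1 := by rw [hc]; ring
      _ ≤ 25 * K ^ 2 * (n + 2) ^ 2 * (M ^ (n + 1) * (n + 1)!) ^ 2 +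
          c * A ^ 2 * (M ^ (n + 1)) ^ 2 * ((n + 1)! : ℝ) ^ 2 * (n + 2 : ℝ) ^ 2 := by
        gcongr
        exact one_le_pow₀ (by linarith [(Nat.cast_nonneg n : (0 : ℝ) ≤ n)])
      _ = (25 * K ^ 2 + c * A ^ 2) * (M ^ (n + 1) * ((n + 2) * (n + 1)!)) ^ 2 := by ring
      _ ≤ M ^ 2 * (M ^ (n + 1) * ((n + 2) * (n + 1)!)) ^ 2 := by gcongr
      _ = _ := by rw [h3]; ring
  refine ⟨M, hM1, fun a b ↦ ?_⟩
  induction a with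
  | zero =>
    induction b with
    | zero => simp; nlinarith
    | succ b ih =>
      have := hstep b 0 (b + 1) (by lia) (dW^[b] U) (by simpa using ih) fun p ↦ by
        simp only [Function.iterate_zero, id, Function.iterate_succ', Function.comp_apply]
        exact sq_norm_dW_le _ _
      simpa [add_assoc] using this
  | succ a ih =>
    have := hstep (a + b) (a + 1) b (by lia) (dZ^[a] (dW^[b] U)) ih fun p ↦ by
        simp only [Function.iterate_succ', Function.comp_apply]
        exact sq_norm_dZ_le _ _
    rw [show a + 1 + b = a + b + 1 by lia]
    exact this

/-- The `L¹` seminorm of a smooth function over a set. -/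
noncomputable def l1 (S : Set (ℝ × ℝ × ℝ)) (v : SmoothFn) : ℝ := ∫ p in S, ‖v p‖

theorem l1_nonneg (S : Set (ℝ × ℝ × ℝ)) (v : SmoothFn) : 0 ≤ l1 S v :=
  integral_nonneg fun _ ↦ norm_nonneg _

theorem integrableOn_norm {S : Set (ℝ × ℝ × ℝ)} (hS : IsCompact S)
    (v : SmoothFn) : IntegrableOn (fun p ↦ ‖v p‖) S :=
  (continuous v).norm.continuousOn.integrableOn_compact hS

theorem l1_add_le {S : Set (ℝ × ℝ × ℝ)} (hS : IsCompact S)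
    (v w : SmoothFn) : l1 S (v + w) ≤ l1 S v + l1 S w := by
  rw [l1, l1, l1, ← integral_add (integrableOn_norm hS v) (integrableOn_norm hS w)]
  exact integral_mono (integrableOn_norm hS _)
    ((integrableOn_norm hS v).add (integrableOn_norm hS w)) fun p ↦ norm_add_le _ _

theorem l1_sub_le {S : Set (ℝ × ℝ × ℝ)} (hS : IsCompact S)
    (v w : SmoothFn) : l1 S (v - w) ≤ l1 S v + l1 S w := by
  rw [l1, l1, l1, ← integral_add (integrableOn_norm hS v) (integrableOn_norm hS w)]
  exact integral_mono (integrableOn_norm hS _)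
    ((integrableOn_norm hS v).add (integrableOn_norm hS w)) fun p ↦ norm_sub_le _ _

theorem l1_mul_le {S : Set (ℝ × ℝ × ℝ)} (hS : IsCompact S)
    (c v : SmoothFn) {K : ℝ} (hc : ∀ p ∈ S, ‖c p‖ ≤ K) :
    l1 S (c * v) ≤ K * l1 S v := by
  rw [l1, l1, ← integral_const_mul]
  refine setIntegral_mono_on (integrableOn_norm hS _) ((integrableOn_norm hS v).const_mul K)
    hS.measurableSet fun p hp ↦ ?_
  rw [mul_apply, norm_mul]
  exact mul_le_mul_of_nonneg_right (hc p hp) (norm_nonneg _)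

theorem l1_le_of_bound {S : Set (ℝ × ℝ × ℝ)} (hS : IsCompact S)
    (v : SmoothFn) {K : ℝ} (hv : ∀ p ∈ S, ‖v p‖ ≤ K) :
    l1 S v ≤ K * volume.real S := by
  have : l1 S v ≤ ∫ p in S, K :=
    setIntegral_mono_on (integrableOn_norm hS _)
      (integrableOn_const hS.measure_lt_top.ne) hS.measurableSet hv
  simpa [mul_comm] using this

theorem l1_le_of_sq {S : Set (ℝ × ℝ × ℝ)} (hS : IsCompact S)
    (v : SmoothFn) {K D : ℝ} (hK : 0 < K)
    (hv : ∫ p in S, ‖v p‖ ^ 2 ≤ D * K ^ 2) : l1 S v ≤ (volume.real S + D) * K := by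
  have hi : IntegrableOn (fun p ↦ ‖v p‖ ^ 2) S :=
    ((continuous v).norm.pow 2).continuousOn.integrableOn_compact hS
  have hc : IntegrableOn (fun _ ↦ K) S := integrableOn_const hS.measure_lt_top.ne
  have h1 : l1 S v ≤ ∫ p in S, (K + ‖v p‖ ^ 2 / K) := by
    refine setIntegral_mono_on (integrableOn_norm hS _) (hc.add (hi.div_const K))
      hS.measurableSet fun p _ ↦ ?_
    have h2 : ‖v p‖ * K ≤ (K + ‖v p‖ ^ 2 / K) * K := by
      rw [add_mul, div_mul_cancel₀ _ hK.ne']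
      nlinarith [sq_nonneg (K - ‖v p‖), norm_nonneg (v p)]
    exact le_of_mul_le_mul_right h2 hK
  rw [integral_add hc (hi.div_const K), integral_div] at h1
  have h3 : (∫ p in S, ‖v p‖ ^ 2) / K ≤ D * K := by
    rw [div_le_iff₀ hK]; linarith
  have h4 : ∫ _p in S, K = volume.real S * K := by simp
  rw [h4] at h1
  linarith

theorem l1_angN_le {S : Set (ℝ × ℝ × ℝ)} (hS : IsCompact S)
    (hz : ∀ p ∈ S, ‖cz p‖ ≤ 1) (hw : ∀ p ∈ S, ‖cw p‖ ≤ 1) (m : ℤ) (v : SmoothFn) :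
    l1 S (angN m v) ≤ l1 S (dZ v) + l1 S (dW v) + |(m : ℝ)| * l1 S v := by
  have h1 := l1_mul_le hS cz (dZ v) hz
  have h2 := l1_mul_le hS cw (dW v) hw
  have h3 := l1_mul_le hS (m : SmoothFn) v (K := |(m : ℝ)|) (fun p _ ↦ by simp)
  have h4 := l1_add_le hS (cz * dZ v - cw * dW v) (m * v)
  have h5 := l1_sub_le hS (cz * dZ v) (cw * dW v)
  rw [angN]
  linarith

theorem dT_iterate_ct_mul (j : ℕ) (v : SmoothFn) :
    dT^[j] (ct * v) = ct * dT^[j] v + j * dT^[j - 1] v := by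
  induction j with
  | zero => simp
  | succ j ih =>
    rw [Function.iterate_succ_apply', ih, Function.iterate_succ_apply']
    rcases j with _ | j
    · simp [add_comm]
    · simp only [Nat.add_sub_cancel, map_add, Derivation.leibniz, dT_ct, smul_eq_mul,
        Derivation.map_natCast, ← Function.iterate_succ_apply' (f := dT)]
      push_cast
      ring

theorem l1_dT_iterate_ct_mul_le {S : Set (ℝ × ℝ × ℝ)} (hS : IsCompact S)
    (ht : ∀ p ∈ S, ‖ct p‖ ≤ 1) {v : SmoothFn} {D L : ℝ} {n j : ℕ}
    (hD : 0 ≤ D) (hL : 1 ≤ L) (h : ∀ i ≤ j, l1 S (dT^[i] v) ≤ D * L ^ i * (i + n)!) :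
    ∀ i ≤ j, l1 S (dT^[i] (ct * v)) ≤ 2 * D * L ^ i * (i + n)! := by
  intro i hi
  rw [dT_iterate_ct_mul]
  have h1 := l1_add_le hS (ct * dT^[i] v) (i * dT^[i - 1] v)
  have h2 := l1_mul_le hS ct (dT^[i] v) ht
  have h3 := l1_mul_le hS (i : SmoothFn) (dT^[i - 1] v) (K := i) (fun p _ ↦ by simp)
  have h4 : (i : ℝ) * l1 S (dT^[i - 1] v) ≤ D * L ^ i * (i + n)! := by
    rcases i with _ | i
    · simp; positivity
    · have h5 := h i (by lia)
      have h6 : (((i + 1 + n)! : ℕ) : ℝ) = (i + 1 + n) * (i + n)! := by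
        rw [show i + 1 + n = (i + n) + 1 by lia, Nat.factorial_succ]; push_cast; ring
      calc ((i + 1 : ℕ) : ℝ) * l1 S (dT^[i + 1 - 1] v)
          ≤ (i + 1 + n) * (D * L ^ (i + 1) * (i + n)!) := by
            push_cast
            refine mul_le_mul (by linarith [(Nat.cast_nonneg n : (0 : ℝ) ≤ n)]) (h5.trans ?_)
              (l1_nonneg _ _) (by positivity)
            gcongr
            exact Nat.le_succ i
        _ = _ := by rw [h6]; ring
  have h7 := h i hi
  linarith

theorem dT_iterate_angN (m : ℤ) (j : ℕ) (f : SmoothFn) :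
    dT^[j] (angN m f) = angN m (dT^[j] f) := by
  induction j with
  | zero => rfl
  | succ j ih => rw [Function.iterate_succ_apply', ih, dT_angN, Function.iterate_succ_apply']

theorem dZ_dT_iterate (j : ℕ) (f : SmoothFn) : dZ (dT^[j] f) = dT^[j] (dZ f) := by
  induction j with
  | zero => rfl
  | succ j ih => rw [Function.iterate_succ_apply', dZ_dT, ih, Function.iterate_succ_apply']

theorem dW_dT_iterate (j : ℕ) (f : SmoothFn) : dW (dT^[j] f) = dT^[j] (dW f) := by
  induction j with
  | zero => rfl
  | succ j ih => rw [Function.iterate_succ_apply', dW_dT, ih, Function.iterate_succ_apply']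

theorem dW_dZ_iterate (j : ℕ) (f : SmoothFn) : dW (dZ^[j] f) = dZ^[j] (dW f) := by
  induction j with
  | zero => rfl
  | succ j ih => rw [Function.iterate_succ_apply', dW_dZ, ih, Function.iterate_succ_apply']

/-- The mixed derivatives `∂_t^j ∂_z^a ∂_z̄^b f`. -/
noncomputable def mixed (f : SmoothFn) (j a b : ℕ) : SmoothFn := dT^[j] (dZ^[a] (dW^[b] f))

theorem dT_mixed (f : SmoothFn) (j a b : ℕ) : dT (mixed f j a b) = mixed f (j + 1) a b :=
  (Function.iterate_succ_apply' _ _ _).symm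

theorem dZ_mixed (f : SmoothFn) (j a b : ℕ) : dZ (mixed f j a b) = mixed f j (a + 1) b := by
  rw [mixed, mixed, dZ_dT_iterate, Function.iterate_succ_apply']

theorem dW_mixed (f : SmoothFn) (j a b : ℕ) : dW (mixed f j a b) = mixed f j a (b + 1) := by
  rw [mixed, mixed, dW_dT_iterate, dW_dZ_iterate, Function.iterate_succ_apply']

theorem mixed_add_two (f : SmoothFn) (j a b : ℕ) :
    mixed f (j + 2) a b = mixed (hangesOp 0 f) j a b
      - 4 * dT^[j] (ct * (ct * mixed f 0 (a + 1) (b + 1)))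
      + angN (a - b) (angN (a - b) (mixed f j a b)) := by
  have h : hangesOp (a - b) (mixed f 0 a b) = mixed (hangesOp 0 f) 0 a b :=
    hangesOp_dZ_iterate_dW_iterate f a b
  rw [hangesOp, dW_mixed, dZ_mixed, dT_mixed, dT_mixed] at h
  have h4 (w : SmoothFn) : dT^[j] (4 * w) = 4 * dT^[j] w := by
    induction j with
    | zero => rfl
    | succ j ih =>
      rw [Function.iterate_succ_apply', ih, Function.iterate_succ_apply', Derivation.leibniz,
        derivation_four]
      simp
  have hadd : ∀ (j : ℕ) (v w : SmoothFn), dT^[j] (v + w) = dT^[j] v + dT^[j] w := fun j ↦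
    iterate_map_add dT j
  have hsub : ∀ (j : ℕ) (v w : SmoothFn), dT^[j] (v - w) = dT^[j] v - dT^[j] w := fun j ↦
    iterate_map_sub dT j
  have e1 : mixed f 2 a b = mixed (hangesOp 0 f) 0 a b
      - 4 * (ct * (ct * mixed f 0 (a + 1) (b + 1)))
      + angN (a - b) (angN (a - b) (mixed f 0 a b)) := by
    rw [← h]; ring
  have e2 := congrArg dT^[j] e1
  rw [hadd, hsub, h4, dT_iterate_angN, dT_iterate_angN] at e2
  rw [← show dT^[j] (mixed f 0 a b) = mixed f j a b from rfl]
  refine Eq.trans ?_ e2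
  exact Function.iterate_add_apply dT j 2 _

theorem l1_mixed_le {S : Set (ℝ × ℝ × ℝ)} (hS : IsCompact S) (ht : ∀ p ∈ S, ‖ct p‖ ≤ 1)
    (hz : ∀ p ∈ S, ‖cz p‖ ≤ 1) (hw : ∀ p ∈ S, ‖cw p‖ ≤ 1) (f : SmoothFn) {C M : ℝ} (hC : 0 ≤ C)
    (hM : 1 ≤ M)
    (hF : ∀ j a b, l1 S (mixed (hangesOp 0 f) j a b) ≤ C * M ^ (j + a + b + 1) * (j + a + b)!)
    (h0 : ∀ a b, l1 S (mixed f 0 a b) ≤ C * M ^ (a + b + 1) * (a + b + 1)!)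
    (h1 : ∀ a b, l1 S (mixed f 1 a b) ≤ C * M ^ (a + b + 1) * (a + b + 1)!) :
    ∀ j a b, l1 S (mixed f j a b) ≤ C * M ^ (a + b + 1) * (6 * M) ^ j * (j + (a + b + 1))! := by
  intro j
  induction j using Nat.strong_induction_on with
  | _ j ih =>
  rcases j with _ | _ | j
  · intro a b
    simpa using h0 a b
  · intro a b
    refine (h1 a b).trans ?_
    rw [mul_assoc _ ((6 * M) ^ (0 + 1))]
    refine mul_le_mul_of_nonneg_left ?_ (by positivity)
    have : ((a + b + 1)! : ℝ) ≤ (0 + 1 + (a + b + 1))! := by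
      exact_mod_cast Nat.factorial_le (by lia)
    have h6 : 1 ≤ (6 * M) ^ (0 + 1) := by rw [zero_add, pow_one]; linarith
    calc ((a + b + 1)! : ℝ) ≤ 1 * (0 + 1 + (a + b + 1))! := by rw [one_mul]; exact this
      _ ≤ _ := by gcongr
  · intro a b
    change l1 S (mixed f (j + 2) a b) ≤ _
    rw [mixed_add_two]
    set k := a + b with hk
    set m : ℤ := a - b with hm
    set L := 6 * M with hL
    have hL1 : 1 ≤ L := by linarith
    have hmk : |(m : ℝ)| ≤ k := by
      rw [hm, hk]; push_cast
      rw [abs_le]; constructor <;> linarith [(Nat.cast_nonneg a : (0 : ℝ) ≤ a),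
        (Nat.cast_nonneg b : (0 : ℝ) ≤ b)]
    obtain ⟨T, hT⟩ : ∃ T : ℝ, T = C * M ^ (k + 1) * L ^ j * (j + 2 + (k + 1))! := ⟨_, rfl⟩
    have hT0 : 0 ≤ T := by rw [hT]; positivity
    have f1 : (((j + 2 + (k + 1))! : ℕ) : ℝ) = (j + k + 3) * (j + (k + 1 + 1))! := by
      rw [show j + 2 + (k + 1) = (j + (k + 1 + 1)) + 1 by lia, Nat.factorial_succ]; push_cast; ring
    have f2 : (((j + (k + 1 + 1))! : ℕ) : ℝ) = (j + k + 2) * (j + (k + 1))! := by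
      rw [show j + (k + 1 + 1) = (j + (k + 1)) + 1 by lia, Nat.factorial_succ]; push_cast; ring
    have j0 : (0 : ℝ) ≤ j := Nat.cast_nonneg j
    have k0 : (0 : ℝ) ≤ k := Nat.cast_nonneg k
    have b0 : ∀ a' b', a' + b' = k → l1 S (mixed f j a' b') * (k * k) ≤ T := fun a' b' h ↦ by
      have := ih j (by lia) a' b'
      rw [h] at this
      calc _ ≤ (C * M ^ (k + 1) * L ^ j * (j + (k + 1))!) * ((j + k + 3) * (j + k + 2)) := by
            gcongr <;> linarith
        _ = T := by rw [hT, f1, f2]; ring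
    have b1 : ∀ a' b', a' + b' = k + 1 → l1 S (mixed f j a' b') * (k + 1) ≤ M ^ 2 * T :=
      fun a' b' h ↦ by
      have := ih j (by lia) a' b'
      rw [h] at this
      calc _ ≤ (C * M ^ (k + 1 + 1) * L ^ j * (j + (k + 1 + 1))!) * (j + k + 3) := by
            gcongr <;> linarith
        _ = M * T := by rw [hT, f1]; ring
        _ ≤ _ := by gcongr; nlinarith
    have b2 : ∀ a' b', a' + b' = k + 2 → l1 S (mixed f j a' b') ≤ M ^ 2 * T := fun a' b' h ↦ by
      have := ih j (by lia) a' b'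
      rw [h] at this
      refine this.trans (le_of_eq ?_)
      rw [hT, show j + (k + 2 + 1) = j + 2 + (k + 1) by lia]; ring
    have bF : l1 S (mixed (hangesOp 0 f) j a b) ≤ T := by
      refine (hF j a b).trans ?_
      rw [hT, show j + a + b + 1 = (k + 1) + j by lia, pow_add, ← mul_assoc]
      have : ((j + a + b)! : ℝ) ≤ (j + 2 + (k + 1))! := by
        exact_mod_cast Nat.factorial_le (by lia)
      gcongr
      linarith
    have bt : l1 S (dT^[j] (ct * (ct * mixed f 0 (a + 1) (b + 1)))) ≤ 4 * (M ^ 2 * T) := by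
      have := l1_dT_iterate_ct_mul_le hS ht (v := ct * mixed f 0 (a + 1) (b + 1)) (L := L)
        (D := 2 * (C * M ^ (k + 3))) (n := k + 3) (j := j) (by positivity) hL1
        (l1_dT_iterate_ct_mul_le hS ht (by positivity) hL1 (fun i hi ↦ ?_)) j le_rfl
      · refine this.trans (le_of_eq ?_)
        rw [hT, show j + (k + 3) = j + 2 + (k + 1) by lia]; ring
      · have := ih i (by lia) (a + 1) (b + 1)
        rw [show a + 1 + (b + 1) + 1 = k + 3 by lia] at this
        refine this.trans (le_of_eq ?_)
        ring
    have n1 := l1_angN_le hS hz hw m (angN m (mixed f j a b))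
    rw [dZ_angN, dW_angN, dZ_mixed, dW_mixed] at n1
    have n2 := l1_angN_le hS hz hw (m + 1) (mixed f j (a + 1) b)
    have n3 := l1_angN_le hS hz hw (m - 1) (mixed f j a (b + 1))
    have n4 := l1_angN_le hS hz hw m (mixed f j a b)
    rw [dZ_mixed, dW_mixed] at n2 n3 n4
    have hm1 : |((m + 1 : ℤ) : ℝ)| ≤ k + 1 := by
      push_cast; exact (abs_add_le _ _).trans (by simpa using hmk)
    have hm2 : |((m - 1 : ℤ) : ℝ)| ≤ k + 1 := by
      push_cast; exact (abs_sub _ _).trans (by simpa using hmk)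
    have p1 := mul_le_mul_of_nonneg_right hm1 (l1_nonneg S (mixed f j (a + 1) b))
    have p2 := mul_le_mul_of_nonneg_right hm2 (l1_nonneg S (mixed f j a (b + 1)))
    have p3 := mul_le_mul_of_nonneg_right hmk (l1_nonneg S (mixed f j a b))
    have p4 := mul_le_mul_of_nonneg_right hmk (l1_nonneg S (angN m (mixed f j a b)))
    have p5 : (k : ℝ) * l1 S (angN m (mixed f j a b)) ≤ 2 * (M ^ 2 * T) + T := by
      have q1 := b1 (a + 1) b (by lia)
      have q2 := b1 a (b + 1) (by lia)
      have q3 := b0 a b hk.symm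
      have q4 : l1 S (angN m (mixed f j a b)) ≤ l1 S (mixed f j (a + 1) b) +
        l1 S (mixed f j a (b + 1)) + k * l1 S (mixed f j a b) := by linarith
      have q5 := mul_le_mul_of_nonneg_left q4 k0
      have q6 := l1_nonneg S (mixed f j (a + 1) b)
      have q7 := l1_nonneg S (mixed f j a (b + 1))
      linarith
    have q1 := b1 (a + 1) b (by lia)
    have q2 := b1 a (b + 1) (by lia)
    have r1 := b2 (a + 1 + 1) b (by lia)
    have r2 := b2 (a + 1) (b + 1) (by lia)
    have r3 := b2 a (b + 1 + 1) (by lia)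
    have s1 := l1_add_le hS (mixed (hangesOp 0 f) j a b
      - 4 * dT^[j] (ct * (ct * mixed f 0 (a + 1) (b + 1)))) (angN m (angN m (mixed f j a b)))
    have s2 := l1_sub_le hS (mixed (hangesOp 0 f) j a b)
      (4 * dT^[j] (ct * (ct * mixed f 0 (a + 1) (b + 1))))
    have s3 := l1_mul_le hS 4 (dT^[j] (ct * (ct * mixed f 0 (a + 1) (b + 1)))) (K := 4)
      (fun p _ ↦ by simp)
    have hMT : T ≤ M ^ 2 * T := le_mul_of_one_le_left hT0 (one_le_pow₀ hM)
    calc _ ≤ 36 * (M ^ 2 * T) := by linarith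
      _ = _ := by rw [hT, hL]; ring

theorem hasCompactSupport_pd (e : ℝ × ℝ × ℝ) {f : SmoothFn} (hf : HasCompactSupport f) :
    HasCompactSupport (pd e f) :=
  (hf.fderiv (𝕜 := ℝ)).comp_left (g := fun L : ℝ × ℝ × ℝ →L[ℝ] ℂ ↦ L e) (by simp)

theorem pd_eq_zero_of_notMem {S : Set (ℝ × ℝ × ℝ)} (hS : IsClosed S) (e : ℝ × ℝ × ℝ)
    {f : SmoothFn} (hf : ∀ p ∉ S, f p = 0) : ∀ p ∉ S, pd e f p = 0 := by
  intro p hp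
  have h1 : tsupport f ⊆ S := closure_minimal (fun q hq ↦ by_contra fun h ↦ hq (hf q h)) hS
  have h2 : fderiv ℝ f p = 0 := by
    by_contra h
    exact hp (h1 (support_fderiv_subset ℝ h))
  rw [pd_apply, h2]
  rfl

theorem enorm_le_lintegral_pd {f : SmoothFn} (hf : HasCompactSupport f) {e : ℝ × ℝ × ℝ}
    (he : ‖e‖ = 1) (p : ℝ × ℝ × ℝ) (t : ℝ) :
    ‖f (p + t • e)‖ₑ ≤ ∫⁻ s : ℝ, ‖pd e f (p + s • e)‖ₑ := by
  have hl : ContDiff ℝ ∞ fun s : ℝ ↦ p + s • e := by fun_prop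
  have hc : ContDiff ℝ 1 fun s : ℝ ↦ f (p + s • e) := ((contDiff f).comp hl).of_le (by simp)
  obtain ⟨R, hR⟩ := hf.isCompact.isBounded.subset_closedBall (0 : ℝ × ℝ × ℝ)
  have hcs : HasCompactSupport fun s : ℝ ↦ f (p + s • e) := by
    refine HasCompactSupport.intro (isCompact_closedBall 0 (R + ‖p‖)) fun s hs ↦ ?_
    by_contra h
    apply hs
    have h1 := hR (subset_tsupport _ h)
    rw [mem_closedBall_zero_iff] at h1 ⊢
    have h2 : ‖s • e‖ ≤ ‖p + s • e‖ + ‖p‖ := by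
      simpa using norm_sub_le (p + s • e) p
    rw [norm_smul, he, mul_one] at h2
    linarith
  have h := HasCompactSupport.enorm_le_lintegral_Ici_deriv hc hcs t
  refine h.trans ((setLIntegral_le_lintegral _ _).trans (le_of_eq ?_))
  congr 1
  ext s
  congr 1
  have hd : HasDerivAt (fun s : ℝ ↦ p + s • e) e s := by
    simpa using ((hasDerivAt_id s).smul_const e).const_add p
  exact ((differentiable f (p + s • e)).hasFDerivAt.comp_hasDerivAt s hd).deriv

theorem enorm_le_lintegral {f : SmoothFn} (hf : HasCompactSupport f) (p : ℝ × ℝ × ℝ) :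
    ‖f p‖ₑ ≤ ∫⁻ q, ‖dY (dX (dT f)) q‖ₑ := by
  have h1 (x y t : ℝ) : ‖f (t, x, y)‖ₑ ≤ ∫⁻ s : ℝ, ‖dT f (s, x, y)‖ₑ := by
    simpa [dT] using enorm_le_lintegral_pd hf (e := (1, 0, 0)) (by simp) (0, x, y) t
  have hf2 := hasCompactSupport_pd (1, 0, 0) hf
  have h2 (x y t : ℝ) : ‖dT f (t, x, y)‖ₑ ≤ ∫⁻ s : ℝ, ‖dX (dT f) (t, s, y)‖ₑ := by
    simpa [dT, dX] using enorm_le_lintegral_pd hf2 (e := (0, 1, 0)) (by simp) (t, 0, y) x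
  have hf3 := hasCompactSupport_pd (0, 1, 0) hf2
  have h3 (x y t : ℝ) : ‖dX (dT f) (t, x, y)‖ₑ ≤ ∫⁻ s : ℝ, ‖dY (dX (dT f)) (t, x, s)‖ₑ := by
    simpa [dT, dX, dY] using enorm_le_lintegral_pd hf3 (e := (0, 0, 1)) (by simp) (t, x, 0) y
  have hc := (continuous (dY (dX (dT f)))).enorm
  obtain ⟨t, x, y⟩ := p
  rw [Measure.volume_eq_prod, lintegral_prod _ hc.measurable.aemeasurable]
  refine (h1 x y t).trans (lintegral_mono fun s ↦ ?_)
  have hc' : Continuous fun z : ℝ × ℝ ↦ ‖dY (dX (dT f)) (s, z)‖ₑ :=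
    hc.comp (Continuous.prodMk_right s)
  rw [Measure.volume_eq_prod ℝ ℝ, lintegral_prod _ hc'.measurable.aemeasurable]
  exact (h2 x y s).trans (lintegral_mono fun x' ↦ h3 x' y s)

theorem norm_le_l1 {S : Set (ℝ × ℝ × ℝ)} (hS : IsCompact S) {f : SmoothFn}
    (hf : ∀ p ∉ S, f p = 0) (p : ℝ × ℝ × ℝ) : ‖f p‖ ≤ l1 S (dY (dX (dT f))) := by
  have hc : HasCompactSupport f := HasCompactSupport.intro hS hf
  have hg : HasCompactSupport (dY (dX (dT f))) :=
    hasCompactSupport_pd _ (hasCompactSupport_pd _ (hasCompactSupport_pd _ hc))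
  have hg0 : ∀ p ∉ S, dY (dX (dT f)) p = 0 := pd_eq_zero_of_notMem hS.isClosed _
    (pd_eq_zero_of_notMem hS.isClosed _ (pd_eq_zero_of_notMem hS.isClosed _ hf))
  have hi : Integrable (dY (dX (dT f))) := (continuous _).integrable_of_hasCompactSupport hg
  rw [l1, setIntegral_eq_integral_of_forall_compl_eq_zero fun q hq ↦ by rw [hg0 q hq, norm_zero]]
  have h := enorm_le_lintegral hc p
  rw [← ofReal_integral_norm_eq_lintegral_enorm hi, ← ofReal_norm] at h
  exact (ENNReal.ofReal_le_ofReal_iff (integral_nonneg fun _ ↦ norm_nonneg _)).1 h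

theorem exists_norm_le_l1 {S : Set (ℝ × ℝ × ℝ)} (hS : IsCompact S) (c : SmoothFn)
    (hc : ∀ p ∉ S, c p = 0) : ∃ K : ℝ, 0 ≤ K ∧ ∀ (w : SmoothFn) (p : ℝ × ℝ × ℝ), c p = 1 →
      ‖w p‖ ≤ K * (l1 S w + l1 S (dT w) + l1 S (dX w) + l1 S (dY w) + l1 S (dX (dT w))
        + l1 S (dY (dT w)) + l1 S (dY (dX w)) + l1 S (dY (dX (dT w)))) := by
  have hb (g : SmoothFn) : ∃ K : ℝ, ∀ p ∈ S, ‖g p‖ ≤ K :=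
    hS.exists_bound_of_continuousOn (continuous g).continuousOn
  obtain ⟨K0, h0⟩ := hb c
  obtain ⟨K1, h1⟩ := hb (dT c)
  obtain ⟨K2, h2⟩ := hb (dX c)
  obtain ⟨K3, h3⟩ := hb (dY c)
  obtain ⟨K4, h4⟩ := hb (dX (dT c))
  obtain ⟨K5, h5⟩ := hb (dY (dT c))
  obtain ⟨K6, h6⟩ := hb (dY (dX c))
  obtain ⟨K7, h7⟩ := hb (dY (dX (dT c)))
  set K := |K0| + |K1| + |K2| + |K3| + |K4| + |K5| + |K6| + |K7| with hK
  have := abs_nonneg K0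
  have := abs_nonneg K1
  have := abs_nonneg K2
  have := abs_nonneg K3
  have := abs_nonneg K4
  have := abs_nonneg K5
  have := abs_nonneg K6
  have := abs_nonneg K7
  refine ⟨K, by positivity, fun w p hp ↦ ?_⟩
  have hm (g v : SmoothFn) {k : ℝ} (hg : ∀ p ∈ S, ‖g p‖ ≤ k) (hk : |k| ≤ K) :
      l1 S (g * v) ≤ K * l1 S v :=
    l1_mul_le hS g v fun p hp ↦ (hg p hp).trans ((le_abs_self k).trans hk)
  have e : dY (dX (dT (c * w))) = c * dY (dX (dT w)) + dY c * dX (dT w) + dX c * dY (dT w)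
      + dT c * dY (dX w) + dY (dX c) * dT w + dY (dT c) * dX w + dX (dT c) * dY w
      + dY (dX (dT c)) * w := by
    simp only [Derivation.leibniz, map_add, smul_eq_mul]
    ring
  have h := norm_le_l1 hS (f := c * w) (fun p hp ↦ by rw [mul_apply, hc p hp, zero_mul]) p
  rw [mul_apply, hp, one_mul, e] at h
  refine h.trans ?_
  have a1 := hm c (dY (dX (dT w))) h0 (by linarith)
  have a2 := hm (dY c) (dX (dT w)) h3 (by linarith)
  have a3 := hm (dX c) (dY (dT w)) h2 (by linarith)
  have a4 := hm (dT c) (dY (dX w)) h1 (by linarith)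
  have a5 := hm (dY (dX c)) (dT w) h6 (by linarith)
  have a6 := hm (dY (dT c)) (dX w) h5 (by linarith)
  have a7 := hm (dX (dT c)) (dY w) h4 (by linarith)
  have a8 := hm (dY (dX (dT c))) w h7 (by linarith)
  refine (l1_add_le hS _ _).trans ((add_le_add_left ((l1_add_le hS _ _).trans (add_le_add_left
    ((l1_add_le hS _ _).trans (add_le_add_left ((l1_add_le hS _ _).trans (add_le_add_left
    ((l1_add_le hS _ _).trans (add_le_add_left ((l1_add_le hS _ _).trans (add_le_add_left
    (l1_add_le hS _ _) _)) _)) _)) _)) _)) _).trans ?_)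
  linarith

theorem norm_mixed_le_of_l1_le {S : Set (ℝ × ℝ × ℝ)} (hS : IsCompact S) (c : SmoothFn)
    (hc : ∀ p ∉ S, c p = 0) (f : SmoothFn) {C L : ℝ} (hC : 0 ≤ C) (hL : 1 ≤ L)
    (h : ∀ j a b, l1 S (mixed f j a b) ≤ C * L ^ (j + a + b) * (j + a + b + 1)!) :
    ∃ D : ℝ, 1 ≤ D ∧ ∀ j a b p, c p = 1 →
      ‖mixed f j a b p‖ ≤ D ^ (j + a + b + 1) * (j + a + b)! := by
  obtain ⟨K, hK, hKw⟩ := exists_norm_le_l1 hS c hc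
  let B : ℕ → ℝ := fun n ↦ C * L ^ n * (n + 1)!
  have hB : Monotone B := fun m n hmn ↦ by
    have : ((m + 1)! : ℝ) ≤ (n + 1)! := by exact_mod_cast Nat.factorial_le (by lia)
    simp only [B]
    gcongr
  have hB' (n j a b : ℕ) (hn : j + a + b ≤ n) : l1 S (mixed f j a b) ≤ B n :=
    (h j a b).trans (hB hn)
  have hX (n j a b : ℕ) (hn : j + a + b + 1 ≤ n) : l1 S (dX (mixed f j a b)) ≤ 2 * B n := by
    rw [dX_eq, dZ_mixed, dW_mixed]
    have h1 := l1_add_le hS (mixed f j (a + 1) b) (mixed f j a (b + 1))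
    have h2 := hB' n j (a + 1) b (by lia)
    have h3 := hB' n j a (b + 1) (by lia)
    linarith
  have hY (n j a b : ℕ) (hn : j + a + b + 1 ≤ n) : l1 S (dY (mixed f j a b)) ≤ 2 * B n := by
    rw [dY_eq, dZ_mixed, dW_mixed]
    have h0 := l1_mul_le hS ci (mixed f j (a + 1) b - mixed f j a (b + 1)) (K := 1)
      (fun p _ ↦ by simp)
    have h1 := l1_sub_le hS (mixed f j (a + 1) b) (mixed f j a (b + 1))
    have h2 := hB' n j (a + 1) b (by lia)
    have h3 := hB' n j a (b + 1) (by lia)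
    linarith
  have hYX (n j a b : ℕ) (hn : j + a + b + 2 ≤ n) :
      l1 S (dY (dX (mixed f j a b))) ≤ 4 * B n := by
    rw [dX_eq, dZ_mixed, dW_mixed, map_add]
    have h1 := l1_add_le hS (dY (mixed f j (a + 1) b)) (dY (mixed f j a (b + 1)))
    have h2 := hY n j (a + 1) b (by lia)
    have h3 := hY n j a (b + 1) (by lia)
    linarith
  set E := 18 * K * C * L ^ 3 * 24 * 2 ^ 4 with hE
  have hE0 : 0 ≤ E := by positivity
  refine ⟨1 + E + 2 * L, by linarith, fun j a b p hp ↦ ?_⟩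
  set n := j + a + b with hn
  have key : ‖mixed f j a b p‖ ≤ K * (18 * B (n + 3)) := by
    refine (hKw _ p hp).trans (mul_le_mul_of_nonneg_left ?_ hK)
    have t0 := hB' (n + 3) j a b (by lia)
    have t1 := hB' (n + 3) (j + 1) a b (by lia)
    have t2 := hX (n + 3) j a b (by lia)
    have t3 := hY (n + 3) j a b (by lia)
    have t4 := hX (n + 3) (j + 1) a b (by lia)
    have t5 := hY (n + 3) (j + 1) a b (by lia)
    have t6 := hYX (n + 3) j a b (by lia)
    have t7 := hYX (n + 3) (j + 1) a b (by lia)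
    rw [dT_mixed]
    linarith
  refine key.trans ?_
  have hfac : ((n + 3 + 1)! : ℝ) ≤ n ! * 24 * 2 ^ (n + 4) := by
    have h1 := Nat.add_choose_mul_factorial_mul_factorial n 4
    have h2 : (n + 4).choose 4 ≤ 2 ^ (n + 4) := Nat.choose_le_two_pow _ _
    have h3 : (n + 3 + 1)! ≤ n ! * 24 * 2 ^ (n + 4) := by
      change (n + 4)! ≤ _
      rw [← h1, show 4 ! = 24 from rfl]
      calc (n + 4).choose 4 * n ! * 24 = n ! * 24 * (n + 4).choose 4 := by ring
        _ ≤ _ := Nat.mul_le_mul_left _ h2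
    exact_mod_cast h3
  calc K * (18 * (C * L ^ (n + 3) * (n + 3 + 1)!))
      ≤ K * (18 * (C * L ^ (n + 3) * (n ! * 24 * 2 ^ (n + 4)))) := by gcongr
    _ = E * (2 * L) ^ n * n ! := by rw [hE]; ring
    _ ≤ (1 + E + 2 * L) * (1 + E + 2 * L) ^ n * n ! := by
      gcongr <;> linarith
    _ = _ := by ring

theorem norm_iteratedFDeriv_iterate_le {d : SmoothFn → SmoothFn}
    (L : (ℝ × ℝ × ℝ →L[ℝ] ℂ) →L[ℝ] ℂ) (hd : ∀ f p, d f p = L (fderiv ℝ f p)) (n j : ℕ)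
    (f : SmoothFn) (p : ℝ × ℝ × ℝ) :
    ‖iteratedFDeriv ℝ n (d^[j] f) p‖ ≤ ‖L‖ ^ j * ‖iteratedFDeriv ℝ (n + j) f p‖ := by
  induction j generalizing n with
  | zero => simp
  | succ j ih =>
    rw [Function.iterate_succ_apply']
    have e : (d (d^[j] f) : ℝ × ℝ × ℝ → ℂ) = L ∘ fderiv ℝ (d^[j] f) := funext fun q ↦ hd _ q
    have hc : ContDiff ℝ ∞ (fderiv ℝ (d^[j] f)) := (contDiff (d^[j] f)).fderiv_right (by simp)
    rw [e]
    refine (L.norm_iteratedFDeriv_comp_left hc.contDiffAt (n := n)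
      (by exact_mod_cast le_top)).trans ?_
    rw [norm_iteratedFDeriv_fderiv]
    calc _ ≤ ‖L‖ * (‖L‖ ^ j * ‖iteratedFDeriv ℝ (n + 1 + j) f p‖) := by
          gcongr; exact ih _
      _ = _ := by rw [pow_succ', mul_assoc, show n + 1 + j = n + (j + 1) by ring]

/-- Evaluation of a linear form at a vector. -/
noncomputable def evalCLM (e : ℝ × ℝ × ℝ) : (ℝ × ℝ × ℝ →L[ℝ] ℂ) →L[ℝ] ℂ :=
  ContinuousLinearMap.apply ℝ ℂ e

theorem exists_norm_mixed_le_norm_iteratedFDeriv : ∃ K : ℝ, 0 ≤ K ∧ ∀ (f : SmoothFn) j a b p,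
    ‖mixed f j a b p‖ ≤ K ^ (j + a + b) * ‖iteratedFDeriv ℝ (j + a + b) f p‖ := by
  let LT := evalCLM (1, 0, 0)
  let LX := evalCLM (0, 1, 0)
  let LY := evalCLM (0, 0, 1)
  let I' : ℂ →L[ℝ] ℂ := ContinuousLinearMap.mul ℝ ℂ Complex.I
  let LZ := (1 / 2 : ℝ) • (LX - I'.comp LY)
  let LW := (1 / 2 : ℝ) • (LX + I'.comp LY)
  have hT (f : SmoothFn) (p : ℝ × ℝ × ℝ) : dT f p = LT (fderiv ℝ f p) := rfl
  have hZ (f : SmoothFn) (p : ℝ × ℝ × ℝ) : dZ f p = LZ (fderiv ℝ f p) := by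
    rw [dZ_eq]; simp [LZ, I', LX, LY, dX, dY, pd_apply, evalCLM]
  have hW (f : SmoothFn) (p : ℝ × ℝ × ℝ) : dW f p = LW (fderiv ℝ f p) := by
    rw [dW_eq]; simp [LW, I', LX, LY, dX, dY, pd_apply, evalCLM]
  refine ⟨‖LT‖ + ‖LZ‖ + ‖LW‖, by positivity, fun f j a b p ↦ ?_⟩
  set K := ‖LT‖ + ‖LZ‖ + ‖LW‖ with hK
  have kT : ‖LT‖ ≤ K := by linarith [norm_nonneg LZ, norm_nonneg LW]
  have kZ : ‖LZ‖ ≤ K := by linarith [norm_nonneg LT, norm_nonneg LW]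
  have kW : ‖LW‖ ≤ K := by linarith [norm_nonneg LZ, norm_nonneg LT]
  have h1 := norm_iteratedFDeriv_iterate_le LT hT 0 j (dZ^[a] (dW^[b] f)) p
  have h2 := norm_iteratedFDeriv_iterate_le LZ hZ (0 + j) a (dW^[b] f) p
  have h3 := norm_iteratedFDeriv_iterate_le LW hW (0 + j + a) b f p
  rw [norm_iteratedFDeriv_zero] at h1
  calc ‖mixed f j a b p‖ ≤ ‖LT‖ ^ j * (‖LZ‖ ^ a * (‖LW‖ ^ b *
        ‖iteratedFDeriv ℝ (0 + j + a + b) f p‖)) := by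
        refine h1.trans (mul_le_mul_of_nonneg_left (h2.trans ?_) (by positivity))
        exact mul_le_mul_of_nonneg_left h3 (by positivity)
    _ ≤ K ^ j * (K ^ a * (K ^ b * ‖iteratedFDeriv ℝ (0 + j + a + b) f p‖)) := by gcongr
    _ = _ := by rw [zero_add]; ring

theorem exists_norm_iteratedFDeriv_le_mixed : ∃ K : ℝ, 1 ≤ K ∧ ∀ (f : SmoothFn) (D : ℝ) p, 0 ≤ D →
    (∀ j a b, ‖mixed f j a b p‖ ≤ D ^ (j + a + b + 1) * (j + a + b)!) →
    ∀ n, ‖iteratedFDeriv ℝ n f p‖ ≤ K ^ n * (D ^ (n + 1) * n !) := by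
  let m (l : ℝ × ℝ × ℝ →L[ℝ] ℂ) : ℂ →L[ℝ] (ℝ × ℝ × ℝ →L[ℝ] ℂ) :=
    ((ContinuousLinearMap.compL ℝ (ℝ × ℝ × ℝ) ℂ ℂ).flip l).comp (ContinuousLinearMap.mul ℝ ℂ)
  have hm (l : ℝ × ℝ × ℝ →L[ℝ] ℂ) (c : ℂ) (v : ℝ × ℝ × ℝ) : m l c v = c * l v := rfl
  let r := Complex.ofRealCLM
  let lt : ℝ × ℝ × ℝ →L[ℝ] ℂ := r.comp (ContinuousLinearMap.fst ℝ ℝ (ℝ × ℝ))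
  let lx : ℝ × ℝ × ℝ →L[ℝ] ℂ :=
    r.comp ((ContinuousLinearMap.fst ℝ ℝ ℝ).comp (ContinuousLinearMap.snd ℝ ℝ (ℝ × ℝ)))
  let ly : ℝ × ℝ × ℝ →L[ℝ] ℂ :=
    r.comp ((ContinuousLinearMap.snd ℝ ℝ ℝ).comp (ContinuousLinearMap.snd ℝ ℝ (ℝ × ℝ)))
  let lz := lx + (ContinuousLinearMap.mul ℝ ℂ Complex.I).comp ly
  let lw := lx - (ContinuousLinearMap.mul ℝ ℂ Complex.I).comp ly
  have hd (f : SmoothFn) : fderiv ℝ f = (m lt ∘ dT f + m lz ∘ dZ f) + m lw ∘ dW f := by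
    refine funext fun p ↦ ContinuousLinearMap.ext fun v ↦ ?_
    have hv : v = v.1 • ((1, 0, 0) : ℝ × ℝ × ℝ) + v.2.1 • ((0, 1, 0) : ℝ × ℝ × ℝ)
        + v.2.2 • ((0, 0, 1) : ℝ × ℝ × ℝ) := by simp
    have h1 : fderiv ℝ f p v = v.1 * dT f p + v.2.1 * dX f p + v.2.2 * dY f p := by
      conv_lhs => rw [hv]
      simp only [map_add, map_smul, Complex.real_smul]
      rfl
    rw [h1, dX_eq, dY_eq]
    simp only [Pi.add_apply, Function.comp_apply, _root_.add_apply, hm, lt, lz, lw,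
      lx, ly, r, _root_.sub_apply, ContinuousLinearMap.comp_apply, add_apply,
      mul_apply, sub_apply, ci_apply, ContinuousLinearMap.mul_apply',
      ContinuousLinearMap.coe_fst', ContinuousLinearMap.coe_snd', Complex.ofRealCLM_apply]
    ring
  have hK1 : 1 ≤ 1 + ‖m lt‖ + ‖m lz‖ + ‖m lw‖ := by
    linarith [norm_nonneg (m lt), norm_nonneg (m lz), norm_nonneg (m lw)]
  refine ⟨1 + ‖m lt‖ + ‖m lz‖ + ‖m lw‖, hK1, fun f D p hD h n ↦ ?_⟩
  set K := 1 + ‖m lt‖ + ‖m lz‖ + ‖m lw‖ with hK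
  have key : ∀ n j a b, ‖iteratedFDeriv ℝ n (mixed f j a b) p‖ ≤
      K ^ n * (D ^ (n + (j + a + b) + 1) * (n + (j + a + b))!) := by
    intro n
    induction n with
    | zero => intro j a b; simpa using h j a b
    | succ n ih =>
      intro j a b
      have hs (l : ℂ →L[ℝ] (ℝ × ℝ × ℝ →L[ℝ] ℂ)) (g : SmoothFn) :
          ContDiffAt ℝ n (l ∘ g) p :=
        ((l.contDiff.comp (contDiff g)).of_le (by exact_mod_cast le_top)).contDiffAt
      have hb (l : ℂ →L[ℝ] (ℝ × ℝ × ℝ →L[ℝ] ℂ)) (j' a' b' : ℕ)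
          (hj : j' + a' + b' = j + a + b + 1) : ‖iteratedFDeriv ℝ n (l ∘ mixed f j' a' b') p‖ ≤
          ‖l‖ * (K ^ n * (D ^ (n + 1 + (j + a + b) + 1) * (n + 1 + (j + a + b))!)) := by
        refine (l.norm_iteratedFDeriv_comp_left (contDiff _).contDiffAt (n := n)
          (by exact_mod_cast le_top)).trans ?_
        gcongr
        have := ih j' a' b'
        rwa [hj, show n + (j + a + b + 1) = n + 1 + (j + a + b) by ring] at this
      have ha {g₁ g₂ : ℝ × ℝ × ℝ → (ℝ × ℝ × ℝ →L[ℝ] ℂ)} (h₁ : ContDiffAt ℝ n g₁ p)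
          (h₂ : ContDiffAt ℝ n g₂ p) : iteratedFDeriv ℝ n (g₁ + g₂) p =
          iteratedFDeriv ℝ n g₁ p + iteratedFDeriv ℝ n g₂ p := iteratedFDeriv_add_apply h₁ h₂
      have hs₂ (l l' : ℂ →L[ℝ] (ℝ × ℝ × ℝ →L[ℝ] ℂ)) (g g' : SmoothFn) :
          ContDiffAt ℝ n (l ∘ g + l' ∘ g') p := (hs l g).add (hs l' g')
      rw [← norm_iteratedFDeriv_fderiv, hd, ha (hs₂ _ _ _ _) (hs _ _),
        ha (hs _ _) (hs _ _), dT_mixed, dZ_mixed, dW_mixed]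
      refine (norm_add₃_le).trans ((add_le_add (add_le_add (hb _ _ _ _ (by ring))
        (hb _ _ _ _ (by ring))) (hb _ _ _ _ (by ring))).trans ?_)
      rw [← add_mul, ← add_mul, pow_succ' K, mul_assoc K]
      gcongr
      linarith
  exact key n 0 0 0

theorem RadialCutoff.setIntegral_le_energy {ρ : ℝ} (χ : RadialCutoff ρ) {S : Set (ℝ × ℝ × ℝ)}
    (hS : IsCompact S) (h1 : ∀ p ∈ S, χ.bump p = 1) (k : ℕ) (v : SmoothFn) {g : ℝ × ℝ × ℝ → ℝ}
    (hg : Continuous g) (hg0 : ∀ p, 0 ≤ g p) {D : ℝ} (hD : ∀ p, g p ≤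
      D * (‖dT v p‖ ^ 2 + p.1 ^ 2 * (‖dX v p‖ ^ 2 + ‖dY v p‖ ^ 2) + ‖v p‖ ^ 2 / 32)) :
    ∫ p in S, g p ≤ D * χ.energy k v := by
  have e : ∫ p in S, g p = ∫ p in S, (χ.bump p ^ (k + 1)) ^ 2 * g p :=
    setIntegral_congr_fun hS.isClosed.measurableSet fun p hp ↦ by simp [h1 p hp]
  rw [e, RadialCutoff.energy, ← integral_const_mul]
  refine (setIntegral_le_integral (χ.integrable_bump_pow k hg)
    (Filter.Eventually.of_forall fun p ↦ mul_nonneg (sq_nonneg _) (hg0 p))).trans ?_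
  refine integral_mono (χ.integrable_bump_pow k hg)
    ((χ.integrable_bump_pow k (continuous_energy v)).const_mul D) fun p ↦ ?_
  have := mul_le_mul_of_nonneg_left (hD p) (sq_nonneg (χ.bump p ^ (k + 1)))
  simp only
  linarith

theorem norm_le_of_sq_le {p : ℝ × ℝ × ℝ} {s : ℝ} (hs : 0 ≤ s)
    (h : p.1 ^ 2 + p.2.1 ^ 2 + p.2.2 ^ 2 ≤ s ^ 2) : ‖p‖ ≤ s := by
  refine norm_prod_le_iff.2 ⟨abs_le_of_sq_le_sq ?_ hs, norm_prod_le_iff.2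
    ⟨abs_le_of_sq_le_sq ?_ hs, abs_le_of_sq_le_sq ?_ hs⟩⟩ <;>
    nlinarith [sq_nonneg p.1, sq_nonneg p.2.1, sq_nonneg p.2.2]

/-- If `hangesOp 0 U` is real-analytic at the origin, then so is the smooth function `U`. -/
theorem analyticAt_zero_of_hangesOp (U : SmoothFn) (hF : AnalyticAt ℝ (hangesOp 0 U) 0) :
    AnalyticAt ℝ U 0 := by
  obtain ⟨r, hr, C, hC, hb⟩ := hF.exists_norm_iteratedFDeriv_le
  obtain ⟨K, hK, hmix⟩ := exists_norm_mixed_le_norm_iteratedFDeriv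
  set A := (1 + K) * C with hA
  have hA0 : 0 ≤ A := by positivity
  have hFb (j a b : ℕ) (p : ℝ × ℝ × ℝ) (hp : p ∈ Metric.ball 0 r) :
      ‖mixed (hangesOp 0 U) j a b p‖ ≤ A ^ (j + a + b + 1) * (j + a + b)! := by
    set n := j + a + b with hn
    calc _ ≤ K ^ n * ‖iteratedFDeriv ℝ n (hangesOp 0 U) p‖ := hmix _ _ _ _ _
      _ ≤ (1 + K) ^ (n + 1) * (C ^ (n + 1) * n !) := by
        have h1 : K ^ n ≤ (1 + K) ^ (n + 1) :=
          (pow_le_pow_left₀ hK (by linarith) n).trans (pow_le_pow_right₀ (by linarith) (by lia))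
        exact mul_le_mul h1 (hb n p hp) (norm_nonneg _) (by positivity)
      _ = A ^ (n + 1) * n ! := by rw [hA, mul_pow]; ring
  obtain ⟨s, hs0, hsr, hs1⟩ : ∃ s : ℝ, 0 < s ∧ s < r ∧ s ≤ 1 :=
    ⟨min (r / 2) 1, by positivity, (min_le_left _ _).trans_lt (by linarith), min_le_right _ _⟩
  obtain ⟨ρ, hρ⟩ : ∃ ρ, ρ = s ^ 2 / 2 := ⟨_, rfl⟩
  have hρ0 : 0 < ρ := by rw [hρ]; positivity
  have hρ1 : 2 * ρ ≤ 1 := by rw [hρ]; nlinarith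
  obtain ⟨χ⟩ := RadialCutoff.nonempty hρ0
  have hball (p : ℝ × ℝ × ℝ) (hp : p.1 ^ 2 + p.2.1 ^ 2 + p.2.2 ^ 2 ≤ 2 * ρ) : ‖p‖ ≤ s :=
    norm_le_of_sq_le hs0.le (by linarith)
  have hballr (p : ℝ × ℝ × ℝ) (hp : p.1 ^ 2 + p.2.1 ^ 2 + p.2.2 ^ 2 ≤ 2 * ρ) :
      p ∈ Metric.ball 0 r := by
    rw [mem_ball_zero_iff]; exact (hball p hp).trans_lt hsr
  obtain ⟨M, hM, hen⟩ := χ.exists_energy_le hρ1 U hA0 fun a b p hp ↦ by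
    have h := hFb 0 a b p (hballr p (not_lt.1 fun h ↦ hp (χ.bump_eq_zero p h.le)))
    simpa [mixed] using h
  set S : Set (ℝ × ℝ × ℝ) := {p | p.1 ^ 2 + p.2.1 ^ 2 + p.2.2 ^ 2 ≤ ρ} with hSdef
  have hSc : IsCompact S := by
    refine (isCompact_closedBall (0 : ℝ × ℝ × ℝ) s).of_isClosed_subset
      (isClosed_le (by fun_prop) continuous_const) fun p hp ↦ ?_
    rw [mem_closedBall_zero_iff]
    have hp' : p.1 ^ 2 + p.2.1 ^ 2 + p.2.2 ^ 2 ≤ ρ := hp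
    exact hball p (by linarith)
  have hSr (p) (hp : p ∈ S) : p ∈ Metric.ball 0 r := by
    have hp' : p.1 ^ 2 + p.2.1 ^ 2 + p.2.2 ^ 2 ≤ ρ := hp
    exact hballr p (by linarith)
  have hSq (p) (hp : p ∈ S) : p.1 ^ 2 + p.2.1 ^ 2 + p.2.2 ^ 2 ≤ 1 := by
    have hp' : p.1 ^ 2 + p.2.1 ^ 2 + p.2.2 ^ 2 ≤ ρ := hp
    linarith
  have hS1 : ∀ p ∈ S, χ.bump p = 1 := fun p hp ↦ χ.eq_one p hp
  have ht : ∀ p ∈ S, ‖ct p‖ ≤ 1 := fun p hp ↦ by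
    rw [ct_apply, Complex.norm_real]
    exact abs_le_of_sq_le_sq (by nlinarith [hSq p hp, sq_nonneg p.2.1, sq_nonneg p.2.2]) zero_le_one
  have hzn (x y : ℝ) (h : x ^ 2 + y ^ 2 ≤ 1) : ‖(x + Complex.I * y : ℂ)‖ ≤ 1 := by
    rw [mul_comm, Complex.norm_add_mul_I]
    exact Real.sqrt_le_one.2 h
  have hz : ∀ p ∈ S, ‖cz p‖ ≤ 1 := fun p hp ↦ by
    have := hzn p.2.1 p.2.2 (by nlinarith [hSq p hp, sq_nonneg p.1])
    simpa [cz] using this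
  have hw : ∀ p ∈ S, ‖cw p‖ ≤ 1 := fun p hp ↦ by
    have := hzn p.2.1 (-p.2.2) (by nlinarith [hSq p hp, sq_nonneg p.1])
    simpa [cw, sub_eq_add_neg] using this
  set V := volume.real S with hV
  have hV0 : 0 ≤ V := measureReal_nonneg
  set M' := M + A with hM'
  have hM'1 : 1 ≤ M' := by linarith
  have hAM (n : ℕ) : A ^ n ≤ M' ^ n := pow_le_pow_left₀ hA0 (by linarith) n
  have hcont (v : SmoothFn) : Continuous fun p ↦ ‖v p‖ ^ 2 := (continuous v).norm.pow 2
  have hmain := l1_mixed_le hSc ht hz hw U (C := V + 32) (M := M') (by positivity) hM'1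
    (fun j a b ↦ by
      refine (l1_le_of_bound hSc _ fun p hp ↦ hFb j a b p (hSr p hp)).trans ?_
      calc A ^ (j + a + b + 1) * (j + a + b)! * V
          ≤ M' ^ (j + a + b + 1) * (j + a + b)! * (V + 32) := by
            gcongr ?_ * _ * ?_
            · exact hAM _
            · linarith
        _ = _ := by ring)
    (fun a b ↦ by
      refine (l1_le_of_sq hSc (mixed U 0 a b) (K := M ^ (a + b + 1) * (a + b + 1)!) (D := 32)
        (by positivity) ?_).trans ?_
      · refine (χ.setIntegral_le_energy hSc hS1 (a + b) (mixed U 0 a b) (hcont _)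
          (fun p ↦ by positivity) (D := 32) fun p ↦ ?_).trans ?_
        · have h1 : 0 ≤ ‖dT (mixed U 0 a b) p‖ ^ 2 + p.1 ^ 2 *
            (‖dX (mixed U 0 a b) p‖ ^ 2 + ‖dY (mixed U 0 a b) p‖ ^ 2) := by positivity
          linarith
        · exact mul_le_mul_of_nonneg_left (hen a b) (by norm_num)
      · rw [mul_assoc (V + 32)]
        gcongr
        linarith)
    (fun a b ↦ by
      refine (l1_le_of_sq hSc (mixed U 1 a b) (K := M ^ (a + b + 1) * (a + b + 1)!) (D := 32)
        (by positivity) ?_).trans ?_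
      · refine (χ.setIntegral_le_energy hSc hS1 (a + b) (mixed U 0 a b) (hcont (mixed U 1 a b))
          (fun p ↦ by positivity) (D := 32) fun p ↦ ?_).trans ?_
        · have h1 : 0 ≤ p.1 ^ 2 * (‖dX (mixed U 0 a b) p‖ ^ 2 + ‖dY (mixed U 0 a b) p‖ ^ 2)
            + ‖mixed U 0 a b p‖ ^ 2 / 32 := by positivity
          have h2 := sq_nonneg ‖mixed U 1 a b p‖
          rw [dT_mixed]
          linarith
        · exact mul_le_mul_of_nonneg_left (hen a b) (by norm_num)
      · rw [mul_assoc (V + 32)]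
        gcongr
        linarith)
  obtain ⟨χ'⟩ := RadialCutoff.nonempty (half_pos hρ0)
  obtain ⟨D, hD, hmixed⟩ := norm_mixed_le_of_l1_le hSc (ofReal χ'.bump χ'.contDiff_bump)
    (fun p hp ↦ by
      have hp' : ρ < p.1 ^ 2 + p.2.1 ^ 2 + p.2.2 ^ 2 := not_le.1 hp
      rw [ofReal_apply, χ'.bump_eq_zero p (by linarith), Complex.ofReal_zero]) U
    (C := (V + 32) * M') (L := 6 * M') (by positivity) (by linarith) fun j a b ↦ by
      refine (hmain j a b).trans ?_
      rw [show j + (a + b + 1) = j + a + b + 1 by ring]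
      gcongr ?_ * _
      calc (V + 32) * M' ^ (a + b + 1) * (6 * M') ^ j
          = (V + 32) * M' * (M' ^ (a + b) * (6 * M') ^ j) := by ring
        _ ≤ (V + 32) * M' * ((6 * M') ^ (a + b) * (6 * M') ^ j) := by
          gcongr
          linarith
        _ = _ := by ring
  obtain ⟨K', hK', hit⟩ := exists_norm_iteratedFDeriv_le_mixed
  have hnear : ∀ᶠ p : ℝ × ℝ × ℝ in nhds 0, p.1 ^ 2 + p.2.1 ^ 2 + p.2.2 ^ 2 < ρ / 2 := by
    have hc : Continuous fun p : ℝ × ℝ × ℝ ↦ p.1 ^ 2 + p.2.1 ^ 2 + p.2.2 ^ 2 := by fun_prop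
    exact hc.continuousAt.eventually_lt continuousAt_const (by simpa using hρ0)
  obtain ⟨r', hr', hsub⟩ := Metric.eventually_nhds_iff_ball.1 hnear
  refine analyticAt_of_norm_iteratedFDeriv_le (C := K' * D) (contDiff U) hr'
    (one_le_mul_of_one_le_of_one_le hK' hD) fun n y hy ↦ ?_
  refine (hit U D y (by linarith) (fun j a b ↦ hmixed j a b y ?_) n).trans ?_
  · rw [ofReal_apply, χ'.eq_one y (hsub y hy).le, Complex.ofReal_one]
  · rw [mul_pow, mul_assoc]
    gcongr
    lia

end SmoothFn

theorem fderiv_eqOn_of_eqOn {f g : ℝ × ℝ × ℝ → ℝ} {O : Set (ℝ × ℝ × ℝ)} (hO : IsOpen O)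
    (h : Set.EqOn f g O) (e : ℝ × ℝ × ℝ) :
    Set.EqOn (fun p ↦ fderiv ℝ f p e) (fun p ↦ fderiv ℝ g p e) O := fun p hp ↦ by
  have : f =ᶠ[nhds p] g := h.eventuallyEq_of_mem (hO.mem_nhds hp)
  simp only [this.fderiv_eq]

theorem Dtheta_eqOn_of_eqOn {f g : ℝ × ℝ × ℝ → ℝ} {O : Set (ℝ × ℝ × ℝ)} (hO : IsOpen O)
    (h : Set.EqOn f g O) : Set.EqOn (Dtheta f) (Dtheta g) O := fun p hp ↦ by
  have h1 : Dx1 f p = Dx1 g p := fderiv_eqOn_of_eqOn hO h _ hp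
  have h2 : Dx2 f p = Dx2 g p := fderiv_eqOn_of_eqOn hO h _ hp
  rw [Dtheta, Dtheta, h1, h2]

theorem PH_eqOn_of_eqOn {f g : ℝ × ℝ × ℝ → ℝ} {O : Set (ℝ × ℝ × ℝ)} (hO : IsOpen O)
    (h : Set.EqOn f g O) : Set.EqOn (PH f) (PH g) O := fun p hp ↦ by
  have h0 : Dt (Dt f) p = Dt (Dt g) p := fderiv_eqOn_of_eqOn hO (fderiv_eqOn_of_eqOn hO h _) _ hp
  have h1 : Dx1 (Dx1 f) p = Dx1 (Dx1 g) p :=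
    fderiv_eqOn_of_eqOn hO (fderiv_eqOn_of_eqOn hO h _) _ hp
  have h2 : Dx2 (Dx2 f) p = Dx2 (Dx2 g) p :=
    fderiv_eqOn_of_eqOn hO (fderiv_eqOn_of_eqOn hO h _) _ hp
  rw [PH, PH, h0, h1, h2, Dtheta_eqOn_of_eqOn hO (Dtheta_eqOn_of_eqOn hO h) hp]

namespace SmoothFn

theorem contDiff_fderiv_apply {f : ℝ × ℝ × ℝ → ℝ} (hf : ContDiff ℝ ∞ f) (e : ℝ × ℝ × ℝ) :
    ContDiff ℝ ∞ fun p ↦ fderiv ℝ f p e :=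
  (hf.fderiv_right (m := ∞) (by simp)).clm_apply contDiff_const

theorem pd_ofReal_eq (e : ℝ × ℝ × ℝ) {f : ℝ × ℝ × ℝ → ℝ} (hf : ContDiff ℝ ∞ f) :
    pd e (ofReal f hf) = ofReal (fun p ↦ fderiv ℝ f p e) (contDiff_fderiv_apply hf e) :=
  ext fun p ↦ pd_ofReal e f hf p

theorem contDiff_Dtheta {f : ℝ × ℝ × ℝ → ℝ} (hf : ContDiff ℝ ∞ f) : ContDiff ℝ ∞ (Dtheta f) :=
  ((contDiff_fst.comp contDiff_snd).mul (contDiff_fderiv_apply hf _)).sub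
    ((contDiff_snd.comp contDiff_snd).mul (contDiff_fderiv_apply hf _))

theorem angN_zero_ofReal {f : ℝ × ℝ × ℝ → ℝ} (hf : ContDiff ℝ ∞ f) :
    angN 0 (ofReal f hf) = -ci * ofReal (Dtheta f) (contDiff_Dtheta hf) := by
  rw [angN_eq, dX, dY, pd_ofReal_eq, pd_ofReal_eq]
  ext p
  simp [Dtheta, Dx1, Dx2]

theorem angN_zero_ci_mul (f : SmoothFn) : angN 0 (-ci * f) = -ci * angN 0 f := by
  simp [angN, Derivation.leibniz]
  ring

theorem hangesOp_zero_ofReal {f : ℝ × ℝ × ℝ → ℝ} (hf : ContDiff ℝ ∞ f) (p : ℝ × ℝ × ℝ) :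
    hangesOp 0 (ofReal f hf) p = (PH f p : ℂ) := by
  rw [hangesOp, four_mul_dZ_dW, angN_zero_ofReal, angN_zero_ci_mul, angN_zero_ofReal, dT, dX, dY]
  simp only [pd_ofReal_eq]
  have h : -ci * (-ci * ofReal (Dtheta (Dtheta f)) (contDiff_Dtheta (contDiff_Dtheta hf))) =
      -ofReal (Dtheta (Dtheta f)) (contDiff_Dtheta (contDiff_Dtheta hf)) := by
    linear_combination ofReal (Dtheta (Dtheta f)) (contDiff_Dtheta (contDiff_Dtheta hf)) * ci_mul_ci
  rw [h]
  simp [PH, Dt, Dx1, Dx2]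
  rfl

theorem exists_contDiff_eqOn {u : ℝ × ℝ × ℝ → ℝ} {U : Set (ℝ × ℝ × ℝ)} (hU : IsOpen U)
    (hU0 : (0 : ℝ × ℝ × ℝ) ∈ U) (hu : ContDiffOn ℝ ∞ u U) :
    ∃ O : Set (ℝ × ℝ × ℝ), IsOpen O ∧ (0 : ℝ × ℝ × ℝ) ∈ O ∧
      ∃ v : ℝ × ℝ × ℝ → ℝ, ContDiff ℝ ∞ v ∧ Set.EqOn v u O := by
  obtain ⟨r, hr, hsub⟩ := Metric.isOpen_iff.1 hU 0 hU0
  obtain ⟨ρ, hρ⟩ : ∃ ρ, ρ = (r / 2) ^ 2 / 2 := ⟨_, rfl⟩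
  have hρ0 : 0 < ρ := by rw [hρ]; positivity
  obtain ⟨χ⟩ := RadialCutoff.nonempty hρ0
  have hq : Continuous fun p : ℝ × ℝ × ℝ ↦ p.1 ^ 2 + p.2.1 ^ 2 + p.2.2 ^ 2 := by fun_prop
  refine ⟨{p | p.1 ^ 2 + p.2.1 ^ 2 + p.2.2 ^ 2 < ρ}, isOpen_lt hq continuous_const,
    by simpa using hρ0, fun p ↦ χ.bump p * u p, contDiff_iff_contDiffAt.2 fun p ↦ ?_,
    fun p hp ↦ ?_⟩
  · by_cases hp : p ∈ U
    · exact χ.contDiff_bump.contDiffAt.mul (hu.contDiffAt (hU.mem_nhds hp))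
    · have hp' : 2 * ρ < p.1 ^ 2 + p.2.1 ^ 2 + p.2.2 ^ 2 := by
        by_contra! h
        refine hp (hsub (mem_ball_zero_iff.2 ?_))
        exact (norm_le_of_sq_le (by positivity) (by linarith)).trans_lt (half_lt_self hr)
      refine (contDiffAt_const (c := (0 : ℝ))).congr_of_eventuallyEq ?_
      filter_upwards [continuousAt_const.eventually_lt hq.continuousAt hp'] with y hy
      rw [χ.bump_eq_zero y hy.le, zero_mul]
  · have hp' : p.1 ^ 2 + p.2.1 ^ 2 + p.2.2 ^ 2 < ρ := hp
    simp only [χ.eq_one p hp'.le, one_mul]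

end SmoothFn

/-- Hanges' operator is analytic hypoelliptic in the sense of germs at the origin:
if `u` is smooth near `0` and `P_H u` is real-analytic near `0`, then `u` is
real-analytic on some neighborhood of `0`. -/
theorem hanges_germ_analytic_hypoelliptic (u : ℝ × ℝ × ℝ → ℝ)
    (U : Set (ℝ × ℝ × ℝ)) (hU : IsOpen U) (hU0 : (0 : ℝ × ℝ × ℝ) ∈ U)
    (hu : ContDiffOn ℝ (⊤ : ℕ∞) u U)
    (V : Set (ℝ × ℝ × ℝ)) (hV : IsOpen V) (hV0 : (0 : ℝ × ℝ × ℝ) ∈ V)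
    (hf : AnalyticOnNhd ℝ (PH u) V) :
    ∃ W : Set (ℝ × ℝ × ℝ), IsOpen W ∧ (0 : ℝ × ℝ × ℝ) ∈ W ∧ AnalyticOnNhd ℝ u W := by
  obtain ⟨O, hO, hO0, v, hv, hvu⟩ := SmoothFn.exists_contDiff_eqOn hU hU0 hu
  have hPH : SmoothFn.hangesOp 0 (SmoothFn.ofReal v hv) =ᶠ[nhds 0]
      Complex.ofRealCLM ∘ PH u := by
    filter_upwards [hO.mem_nhds hO0] with p hp
    rw [SmoothFn.hangesOp_zero_ofReal, PH_eqOn_of_eqOn hO hvu hp]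
    rfl
  have hF : AnalyticAt ℝ (SmoothFn.hangesOp 0 (SmoothFn.ofReal v hv)) 0 :=
    ((Complex.ofRealCLM.analyticAt _).comp (hf 0 hV0)).congr hPH.symm
  have hva := SmoothFn.analyticAt_zero_of_hangesOp _ hF
  have hre : AnalyticAt ℝ (Complex.reCLM ∘ SmoothFn.ofReal v hv) 0 :=
    (Complex.reCLM.analyticAt _).comp hva
  have hua : AnalyticAt ℝ u 0 := by
    refine hre.congr ?_
    filter_upwards [hO.mem_nhds hO0] with p hp
    rw [← hvu hp]
    rfl
  obtain ⟨W, hW, hWo, hW0⟩ := mem_nhds_iff.1 hua.eventually_analyticAt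
  exact ⟨W, hWo, hW0, hW⟩
end

section
/- Let n ≥ 1 and 0 < r < R. There exists a constant C > 0 such that for every integer N ≥ 1 there is a C^∞ function φ : ℝ^n → ℝ with: 0 ≤ φ ≤ 1 everywhere, φ = 1 on the closed ball of radius r centered at 0, φ = 0 outside the open ball of radius R centered at 0, and for every integer m with 1 ≤ m ≤ 3N and every x ∈ ℝ^n, the norm of the m-th iterated (Fréchet) derivative of φ at x is at most C^{m+1} N^m. -/
open MeasureTheory ContinuousLinearMap
open scoped Convolution ContDiff

/-- Young's inequality `‖f ⋆ g‖_∞ ≤ ‖f‖_1 ‖g‖_∞` for a bilinear map of norm at most one. -/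
theorem norm_convolution_le_integral_norm_mul {G E E' F : Type*} [NormedAddCommGroup G]
    [MeasurableSpace G] {μ : Measure G} [NormedAddCommGroup E] [NormedSpace ℝ E]
    [NormedAddCommGroup E'] [NormedSpace ℝ E'] [NormedAddCommGroup F] [NormedSpace ℝ F]
    (L : E →L[ℝ] E' →L[ℝ] F) (hL : ∀ a b, ‖L a b‖ ≤ ‖a‖ * ‖b‖) {f : G → E} {g : G → E'} {B : ℝ}
    (hf : Integrable f μ) (hg : ∀ x, ‖g x‖ ≤ B) (x : G) :
    ‖(f ⋆[L, μ] g) x‖ ≤ (∫ t, ‖f t‖ ∂μ) * B := by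
  rw [← integral_mul_const]
  refine norm_integral_le_of_norm_le (hf.norm.mul_const B) (.of_forall fun t => ?_)
  exact (hL _ _).trans (mul_le_mul_of_nonneg_left (hg _) (norm_nonneg _))

section Mollification

variable {V : Type} [NormedAddCommGroup V] [InnerProductSpace ℝ V] [FiniteDimensional ℝ V]
  [MeasurableSpace V] [BorelSpace V]
  {F : Type} [NormedAddCommGroup F] [NormedSpace ℝ F]

/-- Convolution of a vector-valued function with the scalar kernel `ρ`. -/
noncomputable def mollify (ρ : V → ℝ) (f : V → F) : V → F :=
  ρ ⋆[lsmul ℝ ℝ, volume] f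

variable {ρ : V → ℝ} {f : V → F}

theorem contDiff_mollify (hρ : Continuous ρ) (hf : ContDiff ℝ ∞ f) (hfc : HasCompactSupport f) :
    ContDiff ℝ ∞ (mollify ρ f) :=
  hfc.contDiff_convolution_right _ hρ.locallyIntegrable hf

theorem hasCompactSupport_mollify (hρc : HasCompactSupport ρ) (hfc : HasCompactSupport f) :
    HasCompactSupport (mollify ρ f) :=
  hρc.convolution _ hfc

theorem fderiv_mollify (hρ : Continuous ρ) (hf : ContDiff ℝ ∞ f) (hfc : HasCompactSupport f) :
    fderiv ℝ (mollify ρ f) = mollify ρ (fderiv ℝ f) := by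
  ext1 x
  rw [mollify, (hfc.hasFDerivAt_convolution_right (lsmul ℝ ℝ) hρ.locallyIntegrable
    (hf.of_le (by simp)) x).fderiv]
  rfl

theorem norm_fderiv_mollify_le (hρ : ContDiff ℝ ∞ ρ) (hρc : HasCompactSupport ρ)
    (hf : Continuous f) {B : ℝ} (hB : ∀ x, ‖f x‖ ≤ B) (x : V) :
    ‖fderiv ℝ (mollify ρ f) x‖ ≤ (∫ t, ‖fderiv ℝ ρ t‖) * B := by
  let L : ℝ →L[ℝ] F →L[ℝ] F := lsmul ℝ ℝ
  have hL : ∀ (a : V →L[ℝ] ℝ) (y : F), ‖L.precompL V a y‖ ≤ ‖a‖ * ‖y‖ := fun a y =>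
    opNorm_le_bound _ (by positivity) fun v => by
      calc ‖L.precompL V a y v‖ = ‖a v‖ * ‖y‖ := norm_smul (a v) y
        _ ≤ ‖a‖ * ‖v‖ * ‖y‖ := by gcongr; exact a.le_opNorm v
        _ = ‖a‖ * ‖y‖ * ‖v‖ := by ring
  have hρ' : Integrable (fderiv ℝ ρ) :=
    (hρ.continuous_fderiv (by simp)).integrable_of_hasCompactSupport (hρc.fderiv ℝ)
  have h : HasFDerivAt (mollify ρ f) ((fderiv ℝ ρ ⋆[L.precompL V, volume] f) x) x :=
    hρc.hasFDerivAt_convolution_left L (hρ.of_le (by simp)) hf.locallyIntegrable x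
  rw [h.fderiv]
  exact norm_convolution_le_integral_norm_mul (L.precompL V) hL hρ' hB x

theorem contDiff_and_hasCompactSupport_iterate_mollify (hρ : Continuous ρ)
    (hρc : HasCompactSupport ρ) (hf : ContDiff ℝ ∞ f) (hfc : HasCompactSupport f) (M : ℕ) :
    ContDiff ℝ ∞ ((mollify ρ)^[M] f) ∧ HasCompactSupport ((mollify ρ)^[M] f) := by
  induction M generalizing f with
  | zero => exact ⟨hf, hfc⟩
  | succ M ih => exact ih (contDiff_mollify hρ hf hfc) (hasCompactSupport_mollify hρc hfc)

theorem fderiv_iterate_mollify (hρ : Continuous ρ) (hρc : HasCompactSupport ρ)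
    (hf : ContDiff ℝ ∞ f) (hfc : HasCompactSupport f) (M : ℕ) :
    fderiv ℝ ((mollify ρ)^[M] f) = (mollify ρ)^[M] (fderiv ℝ f) := by
  induction M generalizing f with
  | zero => rfl
  | succ M ih =>
    rw [Function.iterate_succ_apply, Function.iterate_succ_apply, ← fderiv_mollify hρ hf hfc,
      ih (contDiff_mollify hρ hf hfc) (hasCompactSupport_mollify hρc hfc)]

theorem norm_iterate_mollify_le (hρ : Integrable ρ) (hρ1 : ∫ t, ‖ρ t‖ = 1) {B : ℝ}
    (hB : ∀ x, ‖f x‖ ≤ B) (M : ℕ) (x : V) : ‖(mollify ρ)^[M] f x‖ ≤ B := by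
  induction M generalizing f with
  | zero => exact hB x
  | succ M ih =>
    refine ih fun y => ?_
    have h := norm_convolution_le_integral_norm_mul (lsmul ℝ ℝ)
      (fun a z => (norm_smul a z).le) hρ hB y
    rwa [hρ1, one_mul] at h

/-- Each of the first `M` derivatives of an `M`-fold mollification costs one factor `‖Dρ‖_1`. -/
theorem norm_iteratedFDeriv_iterate_mollify_le (hρ : ContDiff ℝ ∞ ρ) (hρc : HasCompactSupport ρ)
    (hρ1 : ∫ t, ‖ρ t‖ = 1) (m : ℕ) {F : Type} [NormedAddCommGroup F] [NormedSpace ℝ F]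
    {f : V → F} (hf : ContDiff ℝ ∞ f) (hfc : HasCompactSupport f) {B : ℝ}
    (hB : ∀ x, ‖f x‖ ≤ B) {M : ℕ} (hm : m ≤ M) (x : V) :
    ‖iteratedFDeriv ℝ m ((mollify ρ)^[M] f) x‖ ≤ (∫ t, ‖fderiv ℝ ρ t‖) ^ m * B := by
  induction m generalizing F M B with
  | zero =>
    rw [norm_iteratedFDeriv_zero, pow_zero, one_mul]
    exact norm_iterate_mollify_le (hρ.continuous.integrable_of_hasCompactSupport hρc) hρ1 hB M x
  | succ m ih =>
    obtain ⟨M, rfl⟩ : ∃ k, M = k + 1 := ⟨M - 1, by omega⟩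
    have hTf := contDiff_mollify hρ.continuous hf hfc
    have hTfc := hasCompactSupport_mollify hρc hfc
    rw [← norm_iteratedFDeriv_fderiv, Function.iterate_succ_apply,
      fderiv_iterate_mollify hρ.continuous hρc hTf hTfc, pow_succ, mul_assoc]
    exact ih (hTf.fderiv_right (by simp)) (hTfc.fderiv ℝ)
      (norm_fderiv_mollify_le hρ hρc hf.continuous hB) (by omega)

theorem iterate_mollify_nonneg {g : V → ℝ} (hρ : ∀ x, 0 ≤ ρ x) (hg : ∀ x, 0 ≤ g x) (M : ℕ)
    (x : V) : 0 ≤ (mollify ρ)^[M] g x := by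
  induction M generalizing g with
  | zero => exact hg x
  | succ M ih => exact ih fun y => integral_nonneg fun t => mul_nonneg (hρ t) (hg _)

/-- Mollifying `M` times preserves the value `c` at points where `g` is `c` on the surrounding
ball of radius `M` times that of the kernel. -/
theorem iterate_mollify_normed_eq (b : ContDiffBump (0 : V)) {g : V → ℝ} {c : ℝ} (M : ℕ) {x : V}
    (h : ∀ y, dist y x ≤ M * b.rOut → g y = c) :
    (mollify (b.normed volume))^[M] g x = c := by
  induction M generalizing g with
  | zero => exact h x (by simp)
  | succ M ih =>
    refine ih fun y hy => ?_
    have hyx : ∀ z ∈ Metric.ball y b.rOut, g z = c := fun z hz => h z <| by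
      have := dist_triangle z y x
      have := Metric.mem_ball.1 hz
      push_cast
      linarith
    have hy' := hyx y (Metric.mem_ball_self b.rOut_pos)
    rw [mollify, b.normed_convolution_eq_right fun z hz => (hyx z hz).trans hy'.symm, hy']

end Mollification

/-- Existence of Ehrenpreis-type localizing functions: cut-off functions `φ_N`
identically `1` on the closed ball of radius `r`, vanishing outside the open ball
of radius `R`, with `‖D^m φ_N‖ ≤ C^{m+1} N^m` for `1 ≤ m ≤ 3N`, where `C` depends
only on `n, r, R`. -/
theorem ehrenpreis_cutoffs (n : ℕ) (hn : 1 ≤ n) (r R : ℝ) (hr : 0 < r) (hrR : r < R) :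
    ∃ C : ℝ, 0 < C ∧ ∀ N : ℕ, 1 ≤ N →
      ∃ φ : EuclideanSpace ℝ (Fin n) → ℝ,
        ContDiff ℝ (⊤ : ℕ∞) φ ∧
        (∀ x, 0 ≤ φ x ∧ φ x ≤ 1) ∧
        (∀ x ∈ Metric.closedBall (0 : EuclideanSpace ℝ (Fin n)) r, φ x = 1) ∧
        (∀ x ∉ Metric.ball (0 : EuclideanSpace ℝ (Fin n)) R, φ x = 0) ∧
        (∀ m : ℕ, 1 ≤ m → m ≤ 3 * N →
          ∀ x, ‖iteratedFDeriv ℝ m φ x‖ ≤ C ^ (m + 1) * (N : ℝ) ^ m) := by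
  let b : ContDiffBump (0 : EuclideanSpace ℝ (Fin n)) := ⟨1 / 2, 1, by norm_num, by norm_num⟩
  set ρ := b.normed volume
  have hρ : ContDiff ℝ ∞ ρ := b.contDiff_normed
  have hρc : HasCompactSupport ρ := b.hasCompactSupport_normed
  have hρ0 : ∀ x, 0 ≤ ρ x := b.nonneg_normed
  have hρ1 : ∫ t, ‖ρ t‖ = 1 := by
    simp_rw [Real.norm_of_nonneg (hρ0 _)]
    exact b.integral_normed
  set K := ∫ t, ‖fderiv ℝ ρ t‖
  have hK : 0 ≤ K := integral_nonneg fun _ => norm_nonneg _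
  have hd : 0 < R - r := sub_pos.2 hrR
  have hC : 0 ≤ 9 / (R - r) * K := by positivity
  refine ⟨9 / (R - r) * K + 1, by positivity, fun N hN => ?_⟩
  have hN0 : (0 : ℝ) < N := by exact_mod_cast hN
  set l : ℝ := 9 / (R - r) * N with hl_def
  have hl : 0 < l := by positivity
  have hlR : l * R = l * r + 9 * N := by
    rw [hl_def]
    field_simp
    ring
  let χ : ContDiffBump (0 : EuclideanSpace ℝ (Fin n)) :=
    ⟨l * r + 3 * N, l * r + 6 * N, by positivity, by linarith⟩
  set ψ := (mollify ρ)^[3 * N] χ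
  have hχ1 : ∀ x, ‖χ x‖ ≤ 1 := fun x => by
    rw [Real.norm_of_nonneg χ.nonneg]
    exact χ.le_one
  have hψ : ContDiff ℝ ∞ ψ := (contDiff_and_hasCompactSupport_iterate_mollify hρ.continuous hρc
    χ.contDiff χ.hasCompactSupport (3 * N)).1
  have hnorm : ∀ x : EuclideanSpace ℝ (Fin n), ‖l • x‖ = l * ‖x‖ := fun x => by
    rw [norm_smul, Real.norm_of_nonneg hl.le]
  refine ⟨fun x => ψ (l • x), hψ.comp (contDiff_const_smul l), fun x => ⟨?_, ?_⟩, fun x hx => ?_,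
    fun x hx => ?_, fun m _ hm x => ?_⟩
  · exact iterate_mollify_nonneg hρ0 (fun _ => χ.nonneg) _ _
  · exact (Real.le_norm_self _).trans (norm_iterate_mollify_le b.integrable_normed hρ1 hχ1 _ _)
  · refine iterate_mollify_normed_eq b _ fun y hy => χ.one_of_mem_closedBall ?_
    rw [mem_closedBall_zero_iff] at hx ⊢
    have hx' := mul_le_mul_of_nonneg_left hx hl.le
    have := norm_le_norm_add_norm_sub' y (l • x)
    rw [dist_eq_norm] at hy
    push_cast at hy
    change ‖y‖ ≤ l * r + 3 * N
    change ‖y - l • x‖ ≤ 3 * N * 1 at hy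
    linarith [hnorm x]
  · refine iterate_mollify_normed_eq b _ fun y hy => χ.zero_of_le_dist ?_
    rw [mem_ball_zero_iff, not_lt] at hx
    have hx' := mul_le_mul_of_nonneg_left hx hl.le
    have := norm_le_norm_add_norm_sub y (l • x)
    rw [dist_eq_norm] at hy
    push_cast at hy
    rw [dist_zero_right]
    change l * r + 6 * N ≤ ‖y‖
    change ‖y - l • x‖ ≤ 3 * N * 1 at hy
    linarith [hnorm x]
  · rw [iteratedFDeriv_comp_const_smul l (hψ.of_le (by exact_mod_cast le_top)), norm_smul, norm_pow,
      Real.norm_of_nonneg hl.le]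
    have key := norm_iteratedFDeriv_iterate_mollify_le hρ hρc hρ1 m χ.contDiff
      χ.hasCompactSupport hχ1 hm (l • x)
    calc l ^ m * ‖iteratedFDeriv ℝ m ψ (l • x)‖ ≤ l ^ m * (K ^ m * 1) := by gcongr
      _ = (9 / (R - r) * K) ^ m * (N : ℝ) ^ m := by rw [hl_def]; ring
      _ ≤ (9 / (R - r) * K + 1) ^ (m + 1) * (N : ℝ) ^ m := by
          gcongr
          calc (9 / (R - r) * K) ^ m ≤ (9 / (R - r) * K + 1) ^ m := by gcongr; linarith
            _ ≤ (9 / (R - r) * K + 1) ^ (m + 1) := pow_le_pow_right₀ (by linarith) m.le_succ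
end
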